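/- arXiv:2305.15672 — 2 statements merged into one kernel-verified Lean document; each statement's English description precedes it below -/
import Mathlib

section
/- There exist a finite alphabet A and nonempty positive words u, v ∈ A⁺ such that the word u v^{-1} over A ∪ A^{-1} is freely reduced (equivalently, the last letters of u and v are distinct) and the one-relator group G = Gp⟨A | u v^{-1} = 1⟩ has undecidable prefix membership problem: the predicate on words over A ∪ A^{-1} given by 'the represented element of G lies in the prefix monoid of the presentation' is not computable. -/
/-- Evaluation of a word over the generators and their formal inverses in a group:
a letter `(i, false)` is sent to `gen i` and a letter `(i, true)` to `(gen i)⁻¹`. -/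
def evalGrpWord {k : ℕ} {G : Type*} [Group G] (gen : Fin k → G)
    (w : List (Fin k × Bool)) : G :=
  (w.map fun p => if p.2 then (gen p.1)⁻¹ else gen p.1).prod

/-- The word `u v⁻¹` over `A ∪ A⁻¹`, written as a list of signed letters, for positive
words `u, v`. -/
def relatorWord {k : ℕ} (u v : List (Fin k)) : List (Fin k × Bool) :=
  u.map (fun i => (i, false)) ++ (v.reverse.map fun i => (i, true))

/-- The prefix monoid of the presentation `Gp⟨A | u v⁻¹ = 1⟩`: the submonoid of the
presented group generated by the images of all prefixes of the relator word `u v⁻¹`. -/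
def prefixMonoid {k : ℕ} (u v : List (Fin k)) :
    Submonoid (PresentedGroup
      ({(u.map FreeGroup.of).prod * ((v.map FreeGroup.of).prod)⁻¹} :
        Set (FreeGroup (Fin k)))) :=
  Submonoid.closure
    {g | ∃ p : List (Fin k × Bool), p <+: relatorWord u v ∧
      g = evalGrpWord (fun i => PresentedGroup.of i) p}

/-! ### Affine machines -/

/-- A rule of an affine machine: in state `src` a number `p * q + r` may be replaced by
`α * q + β`, and the machine moves to state `dst`. -/
structure AffineRule where
  src : ℕ
  p : ℕ
  r : ℕ
  α : ℕ
  β : ℕ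
  dst : ℕ

namespace AffineRule

/-- An injective numbering of the rules. -/
def code (i : AffineRule) : ℕ :=
  Encodable.encode (i.src, i.p, i.r, i.α, i.β, i.dst)

theorem code_injective : Function.Injective code := by
  rintro ⟨⟩ ⟨⟩ h
  simpa [code] using h

/-- Rename the states of a rule. -/
def mapStates (f : ℕ → ℕ) (i : AffineRule) : AffineRule :=
  { i with src := f i.src, dst := f i.dst }

/-- The transition relation of the machine with rules `T`. -/
def Step (T : List AffineRule) (c d : ℕ × ℕ) : Prop :=
  ∃ i ∈ T, ∃ q, c = (i.src, i.p * q + i.r) ∧ d = (i.dst, i.α * q + i.β)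

/-- Reachability in the machine with rules `T`. -/
abbrev Reach (T : List AffineRule) : ℕ × ℕ → ℕ × ℕ → Prop :=
  Relation.ReflTransGen (Step T)

/-- The rule that changes the state and keeps the number. -/
def bridge (s t : ℕ) : AffineRule := ⟨s, 1, 0, 1, 0, t⟩

theorem step_bridge {T : List AffineRule} {s t : ℕ} (h : bridge s t ∈ T) (x : ℕ) :
    Step T (s, x) (t, x) :=
  ⟨_, h, x, by simp [bridge], by simp [bridge]⟩

theorem Reach.mapStates {T T' : List AffineRule} (f : ℕ → ℕ)
    (h : ∀ i ∈ T, i.mapStates f ∈ T') {c d : ℕ × ℕ} (hr : Reach T c d) :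
    Reach T' (f c.1, c.2) (f d.1, d.2) := by
  refine Relation.ReflTransGen.lift (fun c : ℕ × ℕ => (f c.1, c.2)) ?_ _ _ hr
  rintro _ _ ⟨i, hi, q, rfl, rfl⟩
  exact ⟨_, h i hi, q, rfl, rfl⟩

/-- A relation on `ℕ` is affinely realizable if it is the input-output relation of an affine
machine between two of its states. -/
def Realizable (R : ℕ → ℕ → Prop) : Prop :=
  ∃ (T : List AffineRule) (s t : ℕ), (∀ i ∈ T, 0 < i.p) ∧ ∀ x y, R x y ↔ Reach T (s, x) (t, y)

theorem realizable_rules (L : List AffineRule) (hL : ∀ i ∈ L, 0 < i.p) :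
    Realizable fun x y => ∃ i ∈ L, ∃ q, x = i.p * q + i.r ∧ y = i.α * q + i.β := by
  refine ⟨L.map fun i => { i with src := 0, dst := 1 }, 0, 1, by simpa using hL, fun x y => ?_⟩
  constructor
  · rintro ⟨i, hi, q, rfl, rfl⟩
    exact .single ⟨_, List.mem_map_of_mem hi, q, rfl, rfl⟩
  · intro h
    rcases h.cases_head with h | ⟨c, ⟨i, hi, q, h1, rfl⟩, h2⟩
    · simp at h
    · obtain ⟨i, hiL, rfl⟩ := List.mem_map.1 hi
      rcases h2.cases_head with h | ⟨c, ⟨j, hj, q', h3, -⟩, -⟩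
      · simp only [Prod.mk.injEq] at h h1
        exact ⟨i, hiL, q, h1.2, h.2.symm⟩
      · obtain ⟨j, hj, rfl⟩ := List.mem_map.1 hj
        simp at h3

theorem Realizable.comp {R S : ℕ → ℕ → Prop} (hR : Realizable R) (hS : Realizable S) :
    Realizable (Relation.Comp R S) := by
  obtain ⟨T, s, t, hT, hR⟩ := hR
  obtain ⟨T', s', t', hT', hS⟩ := hS
  refine ⟨T.map (mapStates (2 * ·)) ++ T'.map (mapStates (2 * · + 1)) ++
    [bridge (2 * t) (2 * s' + 1)], 2 * s, 2 * t' + 1, ?_, fun x y => ?_⟩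
  · simp only [List.mem_append, List.mem_map, List.mem_singleton]
    rintro i ((⟨j, hj, rfl⟩ | ⟨j, hj, rfl⟩) | rfl)
    · exact hT j hj
    · exact hT' j hj
    · exact one_pos
  constructor
  · rintro ⟨m, h1, h2⟩
    rw [hR] at h1
    rw [hS] at h2
    have h1 := h1.mapStates (T' := T.map (mapStates (2 * ·)) ++ T'.map (mapStates (2 * · + 1)) ++
      [bridge (2 * t) (2 * s' + 1)]) (2 * ·) (by simp +contextual [List.mem_map_of_mem])
    have h2 := h2.mapStates (T' := T.map (mapStates (2 * ·)) ++ T'.map (mapStates (2 * · + 1)) ++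
      [bridge (2 * t) (2 * s' + 1)]) (2 * · + 1) (by
        intro i hi
        simp only [List.mem_append, List.mem_map]
        exact .inl (.inr ⟨i, hi, rfl⟩))
    exact h1.trans (.head (step_bridge (by simp) m) h2)
  · intro h
    have key : ∀ c, Reach (T.map (mapStates (2 * ·)) ++ T'.map (mapStates (2 * · + 1)) ++
        [bridge (2 * t) (2 * s' + 1)]) (2 * s, x) c →
        (∃ k, c.1 = 2 * k ∧ Reach T (s, x) (k, c.2)) ∨
        (∃ k m, c.1 = 2 * k + 1 ∧ R x m ∧ Reach T' (s', m) (k, c.2)) := by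
      intro c hc
      induction hc with
      | refl => exact .inl ⟨s, rfl, .refl⟩
      | tail _ hs ih =>
        obtain ⟨i, hi, q, rfl, rfl⟩ := hs
        simp only [List.mem_append, List.mem_map, List.mem_singleton] at hi
        rcases hi with (⟨j, hj, rfl⟩ | ⟨j, hj, rfl⟩) | rfl
        · rcases ih with ⟨k, hk, h⟩ | ⟨k, m, hk, -⟩
          · obtain rfl : j.src = k := by simpa [mapStates] using hk
            exact .inl ⟨j.dst, rfl, h.tail ⟨j, hj, q, rfl, rfl⟩⟩
          · simp only [mapStates] at hk; omega
        · rcases ih with ⟨k, hk, h⟩ | ⟨k, m, hk, hm, h⟩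
          · simp only [mapStates] at hk; omega
          · obtain rfl : j.src = k := by simpa [mapStates] using hk
            exact .inr ⟨j.dst, m, rfl, hm, h.tail ⟨j, hj, q, rfl, rfl⟩⟩
        · rcases ih with ⟨k, hk, h⟩ | ⟨k, m, hk, -⟩
          · obtain rfl : t = k := by simpa [bridge] using hk
            exact .inr ⟨s', q, rfl, (hR _ _).2 (by simpa [bridge] using h),
              by simpa [bridge] using Relation.ReflTransGen.refl⟩
          · simp only [bridge] at hk; omega
    rcases key _ h with ⟨k, hk, -⟩ | ⟨k, m, hk, hm, h⟩
    · simp only at hk; omega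
    · obtain rfl : t' = k := by simpa using hk
      exact ⟨m, hm, (hS _ _).2 h⟩

theorem Realizable.star {R : ℕ → ℕ → Prop} (hR : Realizable R) :
    Realizable (Relation.ReflTransGen R) := by
  obtain ⟨T, s, t, hT, hR⟩ := hR
  refine ⟨T.map (mapStates (· + 1)) ++ [bridge 0 (s + 1), bridge (t + 1) 0], 0, 0, ?_,
    fun x y => ?_⟩
  · simp only [List.mem_append, List.mem_map, List.mem_cons, List.not_mem_nil, or_false]
    rintro i (⟨j, hj, rfl⟩ | rfl | rfl)
    · exact hT j hj
    · exact one_pos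
    · exact one_pos
  constructor
  · intro h
    induction h with
    | refl => exact .refl
    | @tail u v _ h1 ih =>
      rw [hR] at h1
      have h1 := h1.mapStates (T' := T.map (mapStates (· + 1)) ++
        [bridge 0 (s + 1), bridge (t + 1) 0]) (· + 1) (by simp +contextual [List.mem_map_of_mem])
      exact ih.trans (.head (step_bridge (by simp) u) (h1.tail (step_bridge (by simp) v)))
  · intro h
    have key : ∀ c, Reach (T.map (mapStates (· + 1)) ++ [bridge 0 (s + 1), bridge (t + 1) 0])
        (0, x) c → (c.1 = 0 ∧ Relation.ReflTransGen R x c.2) ∨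
        (∃ k m, c.1 = k + 1 ∧ Relation.ReflTransGen R x m ∧ Reach T (s, m) (k, c.2)) := by
      intro c hc
      induction hc with
      | refl => exact .inl ⟨rfl, .refl⟩
      | tail _ hs ih =>
        obtain ⟨i, hi, q, rfl, rfl⟩ := hs
        simp only [List.mem_append, List.mem_map, List.mem_cons, List.not_mem_nil, or_false] at hi
        rcases hi with ⟨j, hj, rfl⟩ | rfl | rfl
        · rcases ih with ⟨hk, h⟩ | ⟨k, m, hk, hm, h⟩
          · simp [mapStates] at hk
          · obtain rfl : j.src = k := by simpa [mapStates] using hk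
            exact .inr ⟨j.dst, m, rfl, hm, h.tail ⟨j, hj, q, rfl, rfl⟩⟩
        · rcases ih with ⟨hk, h⟩ | ⟨k, m, hk, hm, h⟩
          · exact .inr ⟨s, q, rfl, by simpa [bridge] using h,
              by simpa [bridge] using Relation.ReflTransGen.refl⟩
          · simp [bridge] at hk
        · rcases ih with ⟨hk, h⟩ | ⟨k, m, hk, hm, h⟩
          · simp [bridge] at hk
          · obtain rfl : t = k := by simpa [bridge] using hk
            exact .inl ⟨rfl, by
              simpa [bridge] using hm.tail ((hR _ _).2 (by simpa [bridge] using h))⟩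
    rcases key _ h with ⟨-, h⟩ | ⟨k, m, hk, -⟩
    · exact h
    · simp at hk

end AffineRule

/-! ### Counter programs -/

/-- Programs acting on countably many counters. -/
inductive CounterProg
  | skip
  | inc (i : ℕ)
  | dec (i : ℕ)
  | seq (c d : CounterProg)
  | loop (i : ℕ) (c : CounterProg)

namespace CounterProg

open Function Relation

/-- The input-output relation of a counter program; `dec i` blocks if counter `i` is zero, and
`loop i c` executes `c` until counter `i` is zero. -/
def den : CounterProg → (ℕ → ℕ) → (ℕ → ℕ) → Prop
  | skip, σ, τ => τ = σ
  | inc i, σ, τ => τ = update σ i (σ i + 1)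
  | dec i, σ, τ => σ i ≠ 0 ∧ τ = update σ i (σ i - 1)
  | seq c d, σ, τ => Comp (den c) (den d) σ τ
  | loop i c, σ, τ => ReflTransGen (fun a b => a i ≠ 0 ∧ den c a b) σ τ ∧ τ i = 0

/-- The number `x` encodes the counter values `σ` by its prime factorization. -/
def Represents (x : ℕ) (σ : ℕ → ℕ) : Prop :=
  x ≠ 0 ∧ ∀ i, x.factorization (Nat.nth Nat.Prime i) = σ i

theorem Represents.dvd_iff {x : ℕ} {σ : ℕ → ℕ} (h : Represents x σ) (i : ℕ) :
    Nat.nth Nat.Prime i ∣ x ↔ σ i ≠ 0 := by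
  rw [← h.2 i, (Nat.prime_nth_prime i).dvd_iff_one_le_factorization h.1]
  omega

theorem represents_mul_iff {x : ℕ} {σ : ℕ → ℕ} (i : ℕ) :
    Represents (Nat.nth Nat.Prime i * x) (update σ i (σ i + 1)) ↔ Represents x σ := by
  have hp := Nat.prime_nth_prime i
  unfold Represents
  rw [mul_ne_zero_iff, and_iff_right hp.ne_zero]
  refine and_congr_right fun hx => forall_congr' fun j => ?_
  rw [Nat.factorization_mul hp.ne_zero hx, hp.factorization]
  have hinj := Nat.nth_injective Nat.infinite_setOfPred_prime
  by_cases hj : j = i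
  · subst hj
    simp [add_comm 1]
  · simp [update_of_ne hj, hinj.eq_iff, Ne.symm hj]

/-- Every counter program is simulated by an affine machine. -/
theorem exists_realizable (c : CounterProg) :
    ∃ R, AffineRule.Realizable R ∧ ∀ x σ, Represents x σ →
      (∀ y, R x y → ∃ τ, c.den σ τ ∧ Represents y τ) ∧
      (∀ τ, c.den σ τ → ∃ y, R x y ∧ Represents y τ) := by
  induction c with
  | skip =>
    refine ⟨_, AffineRule.realizable_rules [⟨0, 1, 0, 1, 0, 0⟩] (by simp), fun x σ h => ?_⟩
    simp [den, h]
  | inc i =>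
    refine ⟨_, AffineRule.realizable_rules [⟨0, 1, 0, Nat.nth Nat.Prime i, 0, 0⟩] (by simp),
      fun x σ h => ?_⟩
    simp [den, represents_mul_iff, h]
  | dec i =>
    refine ⟨_, AffineRule.realizable_rules [⟨0, Nat.nth Nat.Prime i, 0, 1, 0, 0⟩]
      (by simpa using (Nat.prime_nth_prime i).pos), fun x σ h => ?_⟩
    have key : ∀ y, x = Nat.nth Nat.Prime i * y →
        σ i ≠ 0 ∧ Represents y (update σ i (σ i - 1)) := by
      rintro y rfl
      have h0 := (h.dvd_iff i).1 (dvd_mul_right _ _)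
      refine ⟨h0, (represents_mul_iff i).1 ?_⟩
      rw [update_self, update_idem, Nat.sub_add_cancel (Nat.pos_of_ne_zero h0), update_eq_self]
      exact h
    simp only [List.mem_singleton, exists_eq_left, add_zero, one_mul, den]
    constructor
    · rintro y ⟨q, hq, rfl⟩
      exact ⟨_, ⟨(key _ hq).1, rfl⟩, (key _ hq).2⟩
    · rintro τ ⟨h0, rfl⟩
      obtain ⟨y, hy⟩ := (h.dvd_iff i).2 h0
      exact ⟨y, ⟨y, hy, rfl⟩, (key _ hy).2⟩
  | seq c d hc hd =>
    obtain ⟨R, hR, hc⟩ := hc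
    obtain ⟨S, hS, hd⟩ := hd
    refine ⟨_, hR.comp hS, fun x σ h => ⟨?_, ?_⟩⟩
    · rintro z ⟨y, hxy, hyz⟩
      obtain ⟨τ, h1, h2⟩ := (hc x σ h).1 y hxy
      obtain ⟨ρ, h3, h4⟩ := (hd y τ h2).1 z hyz
      exact ⟨ρ, ⟨τ, h1, h3⟩, h4⟩
    · rintro ρ ⟨τ, h1, h3⟩
      obtain ⟨y, hxy, h2⟩ := (hc x σ h).2 τ h1
      obtain ⟨z, hyz, h4⟩ := (hd y τ h2).2 ρ h3
      exact ⟨z, ⟨y, hxy, hyz⟩, h4⟩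
  | loop i c hc =>
    obtain ⟨R, hR, hc⟩ := hc
    have hp := Nat.prime_nth_prime i
    have h1 := AffineRule.realizable_rules
      [⟨0, Nat.nth Nat.Prime i, 0, Nat.nth Nat.Prime i, 0, 0⟩] (by simpa using hp.pos)
    have h2 := AffineRule.realizable_rules
      ((List.range (Nat.nth Nat.Prime i - 1)).map fun r =>
        ⟨0, Nat.nth Nat.Prime i, r + 1, Nat.nth Nat.Prime i, r + 1, 0⟩) (by simp [hp.pos])
    refine ⟨_, (h1.comp hR).star.comp h2, fun x σ h => ?_⟩
    set p := Nat.nth Nat.Prime i with hpdef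
    have e1 : ∀ x y, (∃ j ∈ [(⟨0, p, 0, p, 0, 0⟩ : AffineRule)],
        ∃ q, x = j.p * q + j.r ∧ y = j.α * q + j.β) ↔ p ∣ x ∧ y = x := by
      intro x y
      simp only [List.mem_singleton, exists_eq_left, add_zero]
      constructor
      · rintro ⟨q, rfl, rfl⟩
        exact ⟨dvd_mul_right _ _, rfl⟩
      · rintro ⟨⟨q, rfl⟩, rfl⟩
        exact ⟨q, rfl, rfl⟩
    have e2 : ∀ x y, (∃ j ∈ (List.range (p - 1)).map fun r =>
        (⟨0, p, r + 1, p, r + 1, 0⟩ : AffineRule),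
        ∃ q, x = j.p * q + j.r ∧ y = j.α * q + j.β) ↔ ¬ p ∣ x ∧ y = x := by
      intro x y
      simp only [List.mem_map, List.mem_range, exists_exists_and_eq_and]
      constructor
      · rintro ⟨r, hr, q, rfl, rfl⟩
        refine ⟨fun hd => ?_, rfl⟩
        have := Nat.le_of_dvd (by omega) ((Nat.dvd_add_right (dvd_mul_right p q)).1 hd)
        omega
      · rintro ⟨hd, rfl⟩
        have h1 : y % p ≠ 0 := fun h => hd (Nat.dvd_of_mod_eq_zero h)
        have h2 := Nat.mod_lt y hp.pos
        have h3 : p * (y / p) + (y % p - 1 + 1) = y := by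
          have := Nat.div_add_mod y p
          omega
        exact ⟨y % p - 1, by omega, y / p, h3.symm, h3.symm⟩
    simp only [e1, e2]
    constructor
    · rintro z ⟨y, hxy, hyz, rfl⟩
      suffices ∃ τ, ReflTransGen (fun a b => a i ≠ 0 ∧ den c a b) σ τ ∧ Represents z τ by
        obtain ⟨τ, h3, h4⟩ := this
        exact ⟨τ, ⟨h3, by simpa using mt (h4.dvd_iff i).2 hyz⟩, h4⟩
      clear hyz
      induction hxy with
      | refl => exact ⟨σ, .refl, h⟩
      | tail _ hs ih =>
        obtain ⟨τ, h3, h4⟩ := ih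
        obtain ⟨w, ⟨hd, rfl⟩, hw⟩ := hs
        obtain ⟨ρ, h5, h6⟩ := (hc _ _ h4).1 _ hw
        exact ⟨ρ, h3.tail ⟨(h4.dvd_iff i).1 hd, h5⟩, h6⟩
    · rintro τ ⟨hτ, h0⟩
      suffices ∃ y, ReflTransGen (Comp (fun x y => p ∣ x ∧ y = x) R) x y ∧ Represents y τ by
        obtain ⟨y, h3, h4⟩ := this
        exact ⟨y, ⟨y, h3, fun hd => (h4.dvd_iff i).1 hd h0, rfl⟩, h4⟩
      clear h0
      induction hτ with
      | refl => exact ⟨x, .refl, h⟩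
      | tail _ hs ih =>
        obtain ⟨y, h3, h4⟩ := ih
        obtain ⟨z, h5, h6⟩ := (hc _ _ h4).2 _ hs.2
        exact ⟨z, h3.tail ⟨y, ⟨(h4.dvd_iff i).2 hs.1, rfl⟩, h5⟩, h6⟩

theorem den_unique {c : CounterProg} {σ τ ρ : ℕ → ℕ} (h : c.den σ τ) (h' : c.den σ ρ) : τ = ρ := by
  induction c generalizing σ τ ρ with
  | skip => exact Eq.trans h (Eq.symm h')
  | inc i => exact Eq.trans h (Eq.symm h')
  | dec i => exact h.2.trans h'.2.symm
  | seq c d hc hd =>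
    obtain ⟨σ', h1, h2⟩ := h
    obtain ⟨σ'', h3, h4⟩ := h'
    obtain rfl := hc h1 h3
    exact hd h2 h4
  | loop i c hc =>
    obtain ⟨h1, h2⟩ := h
    obtain ⟨h3, h4⟩ := h'
    rcases ReflTransGen.total_of_right_unique (fun a b b' hb hb' => hc hb.2 hb'.2) h1 h3 with h | h
    · rcases h.cases_head with h | ⟨_, ⟨h5, -⟩, -⟩
      · exact h
      · exact absurd h2 h5
    · rcases h.cases_head with h | ⟨_, ⟨h5, -⟩, -⟩
      · exact h.symm
      · exact absurd h4 h5

theorem den_iff {c : CounterProg} {σ ρ : ℕ → ℕ} (h : c.den σ ρ) (τ : ℕ → ℕ) :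
    c.den σ τ ↔ τ = ρ :=
  ⟨fun h' => den_unique h' h, fun h' => h' ▸ h⟩

theorem den_loop {i : ℕ} {c : CounterProg} (S : ℕ → ℕ → ℕ) (n : ℕ)
    (h : ∀ k < n, S k i ≠ 0 ∧ c.den (S k) (S (k + 1))) (hn : S n i = 0) :
    (loop i c).den (S 0) (S n) := by
  refine ⟨?_, hn⟩
  clear hn
  induction n with
  | zero => exact .refl
  | succ n ih => exact (ih fun k hk => h k (by omega)).tail (h n (by omega))

/-- Set counter `i` to zero. -/
def clear (i : ℕ) : CounterProg := loop i (dec i)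

theorem den_clear (i : ℕ) (σ : ℕ → ℕ) : (clear i).den σ (update σ i 0) := by
  have := den_loop (i := i) (c := dec i) (fun k => update σ i (σ i - k)) (σ i) (by
    intro k hk
    refine ⟨by simp; omega, ?_⟩
    simp [den, Nat.sub_sub]
    omega) (by simp)
  simpa [clear] using this

/-- Add counter `i` to counter `j` and set counter `i` to zero. -/
def move (i j : ℕ) : CounterProg := loop i (seq (dec i) (inc j))

theorem den_move {i j : ℕ} (hij : i ≠ j) (σ : ℕ → ℕ) :
    (move i j).den σ (update (update σ j (σ j + σ i)) i 0) := by
  have := den_loop (i := i) (c := seq (dec i) (inc j))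
    (fun k => update (update σ j (σ j + k)) i (σ i - k)) (σ i) (by
    intro k hk
    refine ⟨by simp; omega, _, ⟨by simp; omega, rfl⟩, ?_⟩
    funext l
    simp only [update_apply]
    grind) (by simp)
  simpa [move] using this

/-- Add counter `i` to counter `j`, using the auxiliary counter `t`. -/
def copy (i j t : ℕ) : CounterProg :=
  seq (loop i (seq (dec i) (seq (inc j) (inc t)))) (move t i)

theorem den_copy {i j t : ℕ} (hij : i ≠ j) (hit : i ≠ t) (hjt : j ≠ t) {σ : ℕ → ℕ}
    (ht : σ t = 0) : (copy i j t).den σ (update σ j (σ j + σ i)) := by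
  have h1 := den_loop (i := i) (c := seq (dec i) (seq (inc j) (inc t)))
    (fun k => update (update (update σ j (σ j + k)) i (σ i - k)) t k) (σ i) (by
    intro k hk
    refine ⟨by simp [hit]; omega, _, ⟨by simp [hit]; omega, rfl⟩, _, rfl, ?_⟩
    funext l
    simp only [update_apply]
    grind) (by simp [hit])
  refine ⟨update (update (update σ j (σ j + σ i)) i 0) t (σ i), ?_, ?_⟩
  · convert h1 using 1
    · funext l
      simp only [update_apply]
      grind
    · simp
  · convert den_move hit.symm _ using 1
    funext l
    simp only [update_apply]
    grind

/-- The partial function `f` is computed by counter programs, for any choice of input counters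
`ins` and output counter `out` below a bound `m` above which all counters are free. -/
def Computes {n : ℕ} (f : List.Vector ℕ n →. ℕ) : Prop :=
  ∀ (ins : Fin n → ℕ) (out m : ℕ), (∀ i, ins i < m) → (∀ i, ins i ≠ out) → out < m →
    ∃ c : CounterProg, ∀ σ : ℕ → ℕ, (∀ k, m ≤ k → σ k = 0) → σ out = 0 →
      ∀ τ, c.den σ τ ↔ ∃ y ∈ f (List.Vector.ofFn (σ ∘ ins)), τ = update σ out y

theorem computes_of_total {n : ℕ} {f : List.Vector ℕ n → ℕ}
    (h : ∀ (ins : Fin n → ℕ) (out m : ℕ), (∀ i, ins i < m) → (∀ i, ins i ≠ out) → out < m →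
      ∃ c : CounterProg, ∀ σ : ℕ → ℕ, (∀ k, m ≤ k → σ k = 0) → σ out = 0 →
        c.den σ (update σ out (f (List.Vector.ofFn (σ ∘ ins))))) :
    Computes (f : List.Vector ℕ n →. ℕ) := by
  intro ins out m h1 h2 h3
  obtain ⟨c, hc⟩ := h ins out m h1 h2 h3
  refine ⟨c, fun σ h4 h5 τ => ?_⟩
  rw [den_iff (hc σ h4 h5)]
  simp

theorem Computes.total {n : ℕ} {f : List.Vector ℕ n → ℕ}
    (h : Computes (f : List.Vector ℕ n →. ℕ)) (ins : Fin n → ℕ) (out m : ℕ)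
    (h1 : ∀ i, ins i < m) (h2 : ∀ i, ins i ≠ out) (h3 : out < m) :
      ∃ c : CounterProg, ∀ σ : ℕ → ℕ, (∀ k, m ≤ k → σ k = 0) → σ out = 0 →
        c.den σ (update σ out (f (List.Vector.ofFn (σ ∘ ins)))) := by
  obtain ⟨c, hc⟩ := h ins out m h1 h2 h3
  exact ⟨c, fun σ h4 h5 => (hc σ h4 h5 _).2 ⟨_, by simp, rfl⟩⟩

theorem mem_mOfFn {α : Type*} {n : ℕ} (f : Fin n → Part α) (v : List.Vector α n) :
    v ∈ List.Vector.mOfFn f ↔ ∀ i, v.get i ∈ f i := by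
  induction n with
  | zero => simp [List.Vector.mOfFn, pure, Subsingleton.elim v List.Vector.nil]
  | succ n ih =>
    rw [Fin.forall_fin_succ]
    obtain ⟨a, v, rfl⟩ := v.exists_eq_cons
    simp only [List.Vector.mOfFn, Part.bind_eq_bind, Part.mem_bind_iff, ih, Part.pure_eq_some,
      Part.mem_some_iff]
    constructor
    · rintro ⟨b, hb, w, hw, he⟩
      obtain ⟨rfl, rfl⟩ : a = b ∧ v = w := by
        simpa using And.intro (congrArg List.Vector.head he) (congrArg List.Vector.tail he)
      exact ⟨by simpa using hb, by simpa using hw⟩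
    · rintro ⟨h1, h2⟩
      exact ⟨a, by simpa using h1, v, by simpa using h2, rfl⟩

theorem Computes.rfind {n : ℕ} {f : List.Vector ℕ (n + 1) → ℕ}
    (hf : Computes (f : List.Vector ℕ (n + 1) →. ℕ)) :
    Computes fun v => Nat.rfind fun k => (some (decide (f (k ::ᵥ v) = 0)) : Part Bool) := by
  intro ins out m h1 h2 h3
  obtain ⟨c, hc⟩ := hf.total (Fin.cons out ins) m (m + 1)
    (Fin.cases (by simpa using by omega) fun i => by simpa using (h1 i).trans (Nat.lt_succ_self m))
    (Fin.cases (by simpa using by omega) fun i => by simpa using (h1 i).ne) (by omega)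
  refine ⟨seq c (loop m (seq (clear m) (seq (inc out) c))), fun σ h4 h5 => ?_⟩
  have hσm := h4 m le_rfl
  set v := List.Vector.ofFn (σ ∘ ins) with hv
  have hcS : ∀ k, c.den (update σ out k) (update (update σ out k) m (f (k ::ᵥ v))) := by
    intro k
    have := hc (update σ out k) (fun l hl => by
      rw [update_of_ne (by omega)]; exact h4 l (by omega)) (by
      rw [update_of_ne (by omega)]; exact hσm)
    convert this using 4
    rw [hv]
    congr 1
    · simp
    · congr 1
      funext i
      simp [h2 i]
  have hstart : c.den σ (update (update σ out 0) m (f (0 ::ᵥ v))) := by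
    have := hcS 0
    rwa [(update_eq_self_iff (f := σ) (a := out)).2 h5.symm] at this ⊢
  have hstep : ∀ k, (seq (clear m) (seq (inc out) c)).den
      (update (update σ out k) m (f (k ::ᵥ v)))
      (update (update σ out (k + 1)) m (f ((k + 1) ::ᵥ v))) := by
    intro k
    refine ⟨_, den_clear _ _, _, rfl, ?_⟩
    convert hcS (k + 1) using 1
    funext l
    simp only [update_apply]
    grind
  have hmem : ∀ y, y ∈ (Nat.rfind fun k => (some (decide (f (k ::ᵥ v) = 0)) : Part Bool)) ↔
      f (y ::ᵥ v) = 0 ∧ ∀ k < y, f (k ::ᵥ v) ≠ 0 := by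
    intro y
    refine Nat.mem_rfind.trans ?_
    simp
  intro τ
  constructor
  · rintro ⟨ρ, h6, h7, h8⟩
    obtain rfl := den_unique h6 hstart
    suffices ∃ k, τ = update (update σ out k) m (f (k ::ᵥ v)) ∧ ∀ j < k, f (j ::ᵥ v) ≠ 0 by
      obtain ⟨k, rfl, hk⟩ := this
      rw [update_self] at h8
      refine ⟨k, (hmem k).2 ⟨h8, hk⟩, ?_⟩
      · rw [h8, update_eq_self_iff, update_of_ne (by omega), hσm]
    clear h8
    induction h7 with
    | refl => exact ⟨0, rfl, by simp⟩
    | tail _ hs ih =>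
      obtain ⟨k, rfl, hk⟩ := ih
      refine ⟨k + 1, den_unique hs.2 (hstep k), fun j hj => ?_⟩
      rcases Nat.lt_succ_iff_lt_or_eq.1 hj with hj | rfl
      · exact hk j hj
      · simpa using hs.1
  · rintro ⟨y, hy, rfl⟩
    obtain ⟨hy1, hy2⟩ := (hmem y).1 hy
    refine ⟨_, hstart, ?_⟩
    have := den_loop (i := m) (c := seq (clear m) (seq (inc out) c))
      (fun k => update (update σ out k) m (f (k ::ᵥ v))) y
      (fun k hk => ⟨by simpa using hy2 k hk, hstep k⟩) (by simpa using hy1)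
    convert this using 1
    rw [eq_comm, update_eq_self_iff, update_of_ne (by omega), hσm]
    exact hy1

theorem exists_prog_tuple {n k : ℕ} {g : Fin k → List.Vector ℕ n →. ℕ}
    (hg : ∀ i, Computes (g i)) {ins : Fin n → ℕ} {m : ℕ} (h1 : ∀ i, ins i < m) (j : ℕ)
    (hj : j ≤ k) :
    ∃ c : CounterProg, ∀ σ : ℕ → ℕ, (∀ k, m ≤ k → σ k = 0) → ∀ τ, c.den σ τ ↔
      ∃ ys : ℕ → ℕ, (∀ i : Fin k, i.1 < j → ys i ∈ g i (List.Vector.ofFn (σ ∘ ins))) ∧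
        τ = fun l => if m ≤ l ∧ l < m + j then ys (l - m) else σ l := by
  induction j with
  | zero =>
    refine ⟨skip, fun σ hσ τ => ?_⟩
    have : ∀ l, ¬ (m ≤ l ∧ l < m) := by omega
    simp [den, this]
  | succ j ih =>
    obtain ⟨c, hc⟩ := ih (by omega)
    obtain ⟨d, hd⟩ := hg ⟨j, by omega⟩ ins (m + j) (m + j + 1) (fun i => by have := h1 i; omega)
      (fun i => by have := h1 i; omega) (by omega)
    refine ⟨seq c d, fun σ hσ τ => ?_⟩
    have hd' : ∀ ys : ℕ → ℕ, ∀ τ,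
        d.den (fun l => if m ≤ l ∧ l < m + j then ys (l - m) else σ l) τ ↔
        ∃ y ∈ g ⟨j, by omega⟩ (List.Vector.ofFn (σ ∘ ins)),
          τ = update (fun l => if m ≤ l ∧ l < m + j then ys (l - m) else σ l) (m + j) y := by
      intro ys τ
      rw [hd]
      · have : (fun l => if m ≤ l ∧ l < m + j then ys (l - m) else σ l) ∘ ins = σ ∘ ins := by
          funext i
          have := h1 i
          simp; omega
        rw [this]
      · intro l hl
        rw [if_neg (by omega)]
        exact hσ l (by omega)
      · rw [if_neg (by omega)]
        exact hσ _ (by omega)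
    constructor
    · rintro ⟨ρ, h2, h3⟩
      obtain ⟨ys, hys, rfl⟩ := (hc σ hσ ρ).1 h2
      obtain ⟨y, hy, rfl⟩ := (hd' ys τ).1 h3
      refine ⟨update ys j y, fun i hi => ?_, ?_⟩
      · rcases Nat.lt_succ_iff_lt_or_eq.1 hi with hi | hi
        · rw [update_of_ne hi.ne]
          exact hys i hi
        · subst hi
          simpa using hy
      · funext l
        simp only [update_apply]
        grind
    · rintro ⟨ys, hys, rfl⟩
      refine ⟨_, (hc σ hσ _).2 ⟨ys, fun i hi => hys i (by omega), rfl⟩, (hd' ys _).2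
        ⟨ys j, hys ⟨j, by omega⟩ (by simp), ?_⟩⟩
      funext l
      simp only [update_apply]
      grind

theorem exists_prog_clear (m j : ℕ) :
    ∃ c : CounterProg, ∀ σ : ℕ → ℕ, c.den σ fun l => if m ≤ l ∧ l < m + j then 0 else σ l := by
  induction j with
  | zero =>
    refine ⟨skip, fun σ => ?_⟩
    have : ∀ l, ¬ (m ≤ l ∧ l < m) := by omega
    simp [den, this]
  | succ j ih =>
    obtain ⟨c, hc⟩ := ih
    refine ⟨seq c (clear (m + j)), fun σ => ⟨_, hc σ, ?_⟩⟩
    convert den_clear (m + j) _ using 1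
    funext l
    simp only [update_apply]
    grind

theorem Computes.comp {n k : ℕ} {f : List.Vector ℕ k →. ℕ} {g : Fin k → List.Vector ℕ n →. ℕ}
    (hf : Computes f) (hg : ∀ i, Computes (g i)) :
    Computes fun v => (List.Vector.mOfFn fun i => g i v) >>= f := by
  intro ins out m h1 h2 h3
  obtain ⟨c, hc⟩ := exists_prog_tuple hg h1 k le_rfl
  obtain ⟨d, hd⟩ := hf (fun i => m + i) out (m + k) (fun i => by omega) (fun i => by omega)
    (by omega)
  obtain ⟨e, he⟩ := exists_prog_clear m k
  refine ⟨seq c (seq d e), fun σ h4 h5 τ => ?_⟩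
  have hd' : ∀ ys : ℕ → ℕ, ∀ τ,
      d.den (fun l => if m ≤ l ∧ l < m + k then ys (l - m) else σ l) τ ↔
      ∃ y ∈ f (List.Vector.ofFn fun i => ys i),
        τ = update (fun l => if m ≤ l ∧ l < m + k then ys (l - m) else σ l) out y := by
    intro ys τ
    rw [hd]
    · have : (fun l => if m ≤ l ∧ l < m + k then ys (l - m) else σ l) ∘ (fun i : Fin k => m + i.1)
          = fun i : Fin k => ys i := by
        funext i
        simp
      rw [this]
    · intro l hl
      rw [if_neg (by omega)]
      exact h4 l (by omega)
    · rw [if_neg (by omega)]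
      exact h5
  have he' : ∀ (ys : ℕ → ℕ) (y : ℕ), e.den
      (update (fun l => if m ≤ l ∧ l < m + k then ys (l - m) else σ l) out y)
      (update σ out y) := by
    intro ys y
    convert he _ using 1
    funext l
    simp only [update_apply]
    grind
  have hmem : ∀ w y, y ∈ ((List.Vector.mOfFn fun i => g i w) >>= f) ↔
      ∃ v : List.Vector ℕ k, (∀ i, v.get i ∈ g i w) ∧ y ∈ f v := by
    intro w y
    refine Part.mem_bind_iff.trans ?_
    simp only [mem_mOfFn]
  simp only [hmem]
  constructor
  · rintro ⟨ρ, h6, ρ', h7, h8⟩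
    obtain ⟨ys, hys, rfl⟩ := (hc σ h4 ρ).1 h6
    obtain ⟨y, hy, rfl⟩ := (hd' ys ρ').1 h7
    exact ⟨y, ⟨_, fun i => by simpa using hys i i.2, hy⟩, den_unique h8 (he' ys y)⟩
  · rintro ⟨y, ⟨v, hv, hy⟩, rfl⟩
    set ys : ℕ → ℕ := fun l => if h : l < k then v.get ⟨l, h⟩ else 0 with hys
    refine ⟨_, (hc σ h4 _).2 ⟨ys, fun i hi => by simpa [hys] using hv i, rfl⟩, _,
      (hd' ys _).2 ⟨y, ?_, rfl⟩, he' ys y⟩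
    simpa [hys] using hy

theorem Computes.prec {n : ℕ} {f : List.Vector ℕ n → ℕ} {g : List.Vector ℕ (n + 2) → ℕ}
    {h : List.Vector ℕ (n + 1) → ℕ}
    (hf : Computes (f : List.Vector ℕ n →. ℕ)) (hg : Computes (g : List.Vector ℕ (n + 2) →. ℕ))
    (hh : ∀ v, h v = v.head.rec (f v.tail) fun y IH => g (y ::ᵥ IH ::ᵥ v.tail)) :
    Computes (h : List.Vector ℕ (n + 1) →. ℕ) := by
  refine computes_of_total fun ins out m h1 h2 h3 => ?_
  obtain ⟨c, hc⟩ := hf.total (fun i => ins i.succ) out m (fun i => h1 _) (fun i => h2 _) h3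
  obtain ⟨d, hd⟩ := hg.total (Fin.cons (m + 1) (Fin.cons out fun i => ins i.succ)) (m + 2) (m + 3)
    (Fin.cases (by simp) (Fin.cases (by simpa using by omega)
      fun i => by have := h1 i.succ; simp; omega))
    (Fin.cases (by simp) (Fin.cases (by simpa using by omega)
      fun i => by have := h1 i.succ; simp; omega)) (by omega)
  refine ⟨seq c (seq (copy (ins 0) m (m + 1)) (seq
    (loop m (seq (dec m) (seq d (seq (clear out) (seq (move (m + 2) out) (inc (m + 1)))))))
    (clear (m + 1)))), fun σ h4 h5 => ?_⟩
  set v := List.Vector.ofFn fun i => σ (ins i.succ) with hv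
  have hv' : List.Vector.ofFn (σ ∘ ins) = σ (ins 0) ::ᵥ v := rfl
  rw [hv', hh]
  simp only [List.Vector.head_cons, List.Vector.tail_cons]
  set F : ℕ → ℕ := fun k => k.rec (f v) fun y IH => g (y ::ᵥ IH ::ᵥ v) with hF
  set S : ℕ → ℕ → ℕ := fun k =>
    update (update (update σ out (F k)) m (σ (ins 0) - k)) (m + 1) k with hS
  have hm := h4 m le_rfl
  have hm1 := h4 (m + 1) (by omega)
  have hm2 := h4 (m + 2) (by omega)
  have hi0 := h1 0
  have hi0' := h2 0
  refine ⟨update σ out (F 0), hc σ h4 h5, S 0, ?_, S (σ (ins 0)), ?_, ?_⟩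
  · convert den_copy (i := ins 0) (j := m) (t := m + 1) (by omega) (by omega) (by omega) ?_ using 1
    · funext l
      simp only [hS, update_apply]
      grind
    · rw [update_of_ne (by omega), hm1]
  · refine den_loop S _ (fun k hk => ⟨?_, ?_⟩) ?_
    · simp only [hS, update_apply]
      grind
    · have hd1 := hd (update (S k) m (S k m - 1)) (fun l hl => by
        have := h4 l (by omega)
        simp only [hS, update_apply]
        grind) (by
        simp only [hS, update_apply]
        grind)
      have hval : List.Vector.ofFn (update (S k) m (S k m - 1) ∘
          Fin.cons (m + 1) (Fin.cons out fun i => ins i.succ)) = k ::ᵥ F k ::ᵥ v := by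
        rw [hv]
        change _ ::ᵥ _ ::ᵥ _ = _
        congr 1
        · simp only [hS, comp_apply, Fin.cons_zero, update_apply]
          grind
        · congr 1
          · simp only [hS, comp_apply, Fin.cons_zero, Fin.cons_succ, update_apply]
            grind
          · congr 1
            funext i
            have := h1 i.succ
            have := h2 i.succ
            simp only [hS, comp_apply, Fin.cons_succ, update_apply]
            grind
      rw [hval] at hd1
      have hFk : F (k + 1) = g (k ::ᵥ F k ::ᵥ v) := rfl
      rw [← hFk] at hd1
      refine ⟨_, ⟨?_, rfl⟩, _, hd1, _, den_clear _ _, _, den_move (by omega) _, ?_⟩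
      · simp only [hS, update_apply]
        grind
      · change _ = update _ _ _
        funext l
        simp only [hS, update_apply]
        grind
    · simp only [hS, update_apply]
      grind
  · convert den_clear (m + 1) _ using 1
    funext l
    simp only [hS, update_apply]
    grind

theorem computes_of_primrec' {n : ℕ} {f : List.Vector ℕ n → ℕ} (hf : Nat.Primrec' f) :
    Computes (f : List.Vector ℕ n →. ℕ) := by
  induction hf with
  | zero => 
    refine computes_of_total fun ins out m h1 h2 h3 => ⟨skip, fun σ h4 h5 => ?_⟩
    exact (update_eq_self_iff.2 h5.symm)
  | succ =>
    refine computes_of_total fun ins out m h1 h2 h3 =>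
      ⟨seq (copy (ins 0) out m) (inc out), fun σ h4 h5 =>
        ⟨_, den_copy (h2 0) (h1 0).ne h3.ne (h4 m le_rfl), ?_⟩⟩
    simp [den, h5]
  | get i =>
    refine computes_of_total fun ins out m h1 h2 h3 =>
      ⟨copy (ins i) out m, fun σ h4 h5 => ?_⟩
    simpa [h5] using den_copy (h2 i) (h1 i).ne h3.ne (h4 m le_rfl)
  | comp g _ _ hf hg =>
    refine cast (congrArg Computes ?_) (Computes.comp hf hg)
    funext v
    have : (List.Vector.mOfFn fun i => Part.some (g i v)) = Part.some (.ofFn fun i => g i v) :=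
      List.Vector.mOfFn_pure _
    simp only [PFun.coe_val, this]
    exact Part.bind_some _ _
  | prec _ _ hf hg => exact Computes.prec hf hg fun _ => rfl

theorem computes_of_partrec' {n : ℕ} {f : List.Vector ℕ n →. ℕ} (hf : Nat.Partrec' f) :
    Computes f := by
  induction hf with
  | prim hf => exact computes_of_primrec' hf
  | comp g _ _ hf hg => exact hf.comp hg
  | rfind _ hf => exact hf.rfind

end CounterProg

/-- There is an affine machine with an undecidable halting problem. -/
theorem exists_affine_machine_undecidable :
    ∃ (T : List AffineRule) (s t : ℕ), (∀ i ∈ T, 0 < i.p) ∧ s ≠ t ∧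
      ¬ ComputablePred fun m => AffineRule.Reach T (s, 2 ^ m) (t, 0) := by
  have hf : Partrec fun m : ℕ => (Denumerable.ofNat Nat.Partrec.Code m).eval 0 :=
    Nat.Partrec.Code.eval_part.comp (Computable.ofNat _) (Computable.const 0)
  obtain ⟨c, hc⟩ := CounterProg.computes_of_partrec' (Nat.Partrec'.part_iff₁.2 hf)
    (fun _ => 0) 1 2 (by simp) (by simp) (by simp)
  obtain ⟨R, hR, hsim⟩ := c.exists_realizable
  have hZ := AffineRule.realizable_rules [⟨0, 1, 0, 0, 0, 0⟩] (by simp)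
  obtain ⟨T, s, t, hT, hRT⟩ := hR.comp hZ
  have hrep : ∀ m, CounterProg.Represents (2 ^ m) (Function.update 0 0 m) := by
    intro m
    refine ⟨by positivity, fun i => ?_⟩
    rw [← Nat.nth_prime_zero_eq_two, (Nat.prime_nth_prime 0).factorization_pow,
      Finsupp.single_apply, Function.update_apply]
    have hinj : 2 = Nat.nth Nat.Prime i ↔ 0 = i := by
      rw [← Nat.nth_prime_zero_eq_two]
      exact (Nat.nth_injective Nat.infinite_setOfPred_prime).eq_iff
    simp [hinj, eq_comm]
  have key : ∀ m, AffineRule.Reach T (s, 2 ^ m) (t, 0) ↔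
      ((Denumerable.ofNat Nat.Partrec.Code m).eval 0).Dom := by
    intro m
    rw [← hRT, Part.dom_iff_mem]
    have h := hc (Function.update 0 0 m) (fun k hk => by
      rw [Function.update_of_ne (by omega)]; rfl) rfl
    have hv : (List.Vector.ofFn (Function.update (0 : ℕ → ℕ) 0 m ∘ fun _ : Fin 1 => 0)).head = m :=
      by simp
    simp only [hv] at h
    constructor
    · rintro ⟨y, hy, -⟩
      obtain ⟨τ, h1, -⟩ := (hsim _ _ (hrep m)).1 y hy
      obtain ⟨z, hz, -⟩ := (h τ).1 h1
      exact ⟨z, hz⟩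
    · rintro ⟨z, hz⟩
      obtain ⟨y, hy, -⟩ := (hsim _ _ (hrep m)).2 _ ((h _).2 ⟨z, hz, rfl⟩)
      exact ⟨y, hy, _, List.mem_singleton_self _, y, by simp, by simp⟩
  have hund : ¬ ComputablePred fun m => AffineRule.Reach T (s, 2 ^ m) (t, 0) := by
    intro h
    refine ComputablePred.halting_problem 0 ?_
    refine ComputablePred.computable_of_manyOneReducible
      (q := fun m => AffineRule.Reach T (s, 2 ^ m) (t, 0))
      ⟨Encodable.encode, Computable.encode, fun a => ?_⟩ h
    simp [key]
  refine ⟨T, s, t, hT, ?_, hund⟩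
  rintro rfl
  obtain ⟨y, -, i, hi, q, -, hy⟩ := (hRT 1 1).2 .refl
  obtain rfl := List.mem_singleton.1 hi
  simp at hy

/-! ### A permutation representation -/

namespace MonomialPerm

open Equiv

variable {S ι : Type*}

/-- The permutation of `S × ι` which permutes `ι` by `π` and applies `w i` on the fibre over
`i`. -/
def monomial (π : Perm ι) (w : ι → Perm S) : Perm (S × ι) where
  toFun p := (w p.2 p.1, π p.2)
  invFun p := ((w (π.symm p.2)).symm p.1, π.symm p.2)
  left_inv p := by simp
  right_inv p := by simp

@[simp]
theorem monomial_apply (π : Perm ι) (w : ι → Perm S) (p : S × ι) :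
    monomial π w p = (w p.2 p.1, π p.2) := rfl

theorem monomial_mul (π ρ : Perm ι) (w v : ι → Perm S) :
    monomial π w * monomial ρ v = monomial (π * ρ) fun i => w (ρ i) * v i := by
  ext1 p
  rfl

theorem monomial_eq_one {π : Perm ι} {w : ι → Perm S} (hπ : ∀ i, π i = i) (hw : ∀ i, w i = 1) :
    monomial π w = 1 := by
  ext1 p
  simp [hπ, hw]

theorem monomial_congr {π ρ : Perm ι} {w v : ι → Perm S} (hπ : ∀ i, π i = ρ i)
    (hw : ∀ i, w i = v i) : monomial π w = monomial ρ v := by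
  ext1 p
  simp [hπ, hw]

/-- The element `α ^ i * β ^ j`. -/
def zz {G : Type*} [Group G] (α β : G) (i j : ℤ) : G := α ^ i * β ^ j

theorem zz_mul {G : Type*} [Group G] {α β : G} (h : Commute α β) (i j k l : ℤ) :
    zz α β i j * zz α β k l = zz α β (i + k) (j + l) := by
  unfold zz
  rw [zpow_add, zpow_add, mul_assoc, ← mul_assoc (β ^ j),
    ← (h.zpow_zpow k j).eq, mul_assoc, mul_assoc]

theorem exists_perm_rep {α β θ σ : Perm S} (h : Commute α β) (hθ : θ * α = β * θ)
    (hσ : σ * (α⁻¹ * (β ^ 4)⁻¹) = β * σ) :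
    ∃ (a b t : Perm (S × Bool × Bool)), t * a = b * t ∧ a * b * a * b ^ 3 = 1 ∧
      (∀ q, (a ^ 2) (q, false, false) = (α q, false, false)) ∧
      (∀ q, t (q, false, false) = (θ q, false, false)) := by
  have hm := zz_mul h
  have hm' : ∀ i j k l x, zz α β i j * (zz α β k l * x) = zz α β (i + k) (j + l) * x := by
    intro i j k l x
    rw [← mul_assoc, hm]
  have h0 : zz α β 0 0 = 1 := by simp [zz]
  have hθ' : θ * zz α β 1 0 = zz α β 0 1 * θ := by simpa [zz] using hθ
  have hσ' : σ * zz α β (-1) (-4) = zz α β 0 1 * σ := by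
    simpa [zz, zpow_neg, zpow_ofNat] using hσ
  have h1 : α = zz α β 1 0 := by simp [zz]
  set a : Perm (S × Bool × Bool) := monomial (prodCongr boolNot (Equiv.refl Bool)) fun
    | (false, false) => 1
    | (true, false) => zz α β 1 0
    | (false, true) => 1
    | (true, true) => zz α β (-1) (-4) with ha
  set b : Perm (S × Bool × Bool) := monomial (prodCongr (Equiv.refl Bool) boolNot) fun
    | (false, false) => 1
    | (true, false) => zz α β 1 2
    | (false, true) => zz α β 0 1
    | (true, true) => zz α β (-1) (-1) with hb
  set t : Perm (S × Bool × Bool) := monomial (prodComm Bool Bool) fun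
    | (false, false) => θ
    | (true, false) => θ
    | (false, true) => σ
    | (true, true) => zz α β 1 2 * σ with ht
  refine ⟨a, b, t, ?_, ?_, fun q => ?_, fun q => rfl⟩
  · rw [ha, hb, ht, monomial_mul, monomial_mul]
    refine monomial_congr (by decide) ?_
    rintro ⟨_ | _, _ | _⟩ <;> simp [hθ', hσ', hm']
  · rw [ha, hb, pow_succ, pow_two]
    simp only [monomial_mul]
    refine monomial_eq_one (by decide) ?_
    rintro ⟨_ | _, _ | _⟩ <;> simp [hm, h0]
  · rw [h1, ha, pow_two, monomial_mul]
    simp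

/-- Left multiplication by an element of infinite order, on countably many copies of a countable
group, is conjugate to the shift on countably many copies of `ℤ`. -/
theorem exists_equiv_shift {G : Type*} [Group G] [Countable G] (g : G)
    (hg : Function.Injective fun k : ℤ => g ^ k) :
    ∃ e : G × ℕ ≃ ℕ × ℤ, ∀ x n, e (g * x, n) = ((e (x, n)).1, (e (x, n)).2 + 1) := by
  let s := QuotientGroup.rightRel (Subgroup.zpowers g)
  have hk : ∀ x : G, ∃ k : ℤ, g ^ k * (Quotient.out (Quotient.mk s x)) = x := by
    intro x
    have : s (Quotient.out (Quotient.mk s x)) x := Quotient.mk_out x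
    rw [QuotientGroup.rightRel_apply] at this
    obtain ⟨k, hk⟩ := this
    exact ⟨k, by simp only at hk; rw [hk]; simp⟩
  choose k hk using hk
  have hmk : ∀ (c : Quotient s) (j : ℤ), Quotient.mk s (g ^ j * c.out) = c := by
    intro c j
    conv_rhs => rw [← Quotient.out_eq c]
    refine Quotient.sound ?_
    change s _ _
    rw [QuotientGroup.rightRel_apply]
    exact ⟨-j, by simp⟩
  have hkk : ∀ (c : Quotient s) (j : ℤ), k (g ^ j * c.out) = j := by
    intro c j
    have := hk (g ^ j * c.out)
    rw [hmk] at this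
    exact hg (mul_right_cancel this)
  have hmg : ∀ x, Quotient.mk s (g * x) = Quotient.mk s x := by
    intro x
    refine Quotient.sound ?_
    change s _ _
    rw [QuotientGroup.rightRel_apply]
    exact ⟨-1, by simp⟩
  let e₁ : G ≃ Quotient s × ℤ :=
    { toFun := fun x => (Quotient.mk s x, k x)
      invFun := fun p => g ^ p.2 * p.1.out
      left_inv := hk
      right_inv := fun p => Prod.ext (hmk _ _) (hkk _ _) }
  have hcount : Countable (Quotient s) := inferInstance
  have : Nonempty (Quotient s) := ⟨Quotient.mk s 1⟩
  obtain ⟨e₂⟩ := nonempty_equiv_of_countable (α := Quotient s × ℕ) (β := ℕ)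
  refine ⟨(prodCongr e₁ (Equiv.refl ℕ)).trans
    ((prodAssoc _ _ _).trans ((prodCongr (Equiv.refl _) (prodComm _ _)).trans
      ((prodAssoc _ _ _).symm.trans (prodCongr e₂ (Equiv.refl ℤ))))), fun x n => ?_⟩
  have hkg : k (g * x) = k x + 1 := by
    have h1 := hkk (Quotient.mk s x) (k x + 1)
    rwa [add_comm, zpow_one_add, mul_assoc, hk, add_comm] at h1
  simp [e₁, hmg, hkg]

theorem exists_conj_mulLeft {G : Type*} [Group G] [Countable G] (g g' : G)
    (hg : Function.Injective fun k : ℤ => g ^ k) (hg' : Function.Injective fun k : ℤ => g' ^ k) :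
    ∃ σ : Perm (G × ℕ), ∀ x n, σ (g * x, n) = (g' * (σ (x, n)).1, (σ (x, n)).2) := by
  obtain ⟨e, he⟩ := exists_equiv_shift g hg
  obtain ⟨e', he'⟩ := exists_equiv_shift g' hg'
  refine ⟨e.trans e'.symm, fun x n => e'.injective ?_⟩
  rw [he']
  simp [he]

end MonomialPerm

/-! ### A group with the relator whose fourth powers contain free monoids -/

namespace MonomialPerm

open Equiv

/-- The group in which the tapes of the simulated machine are evaluated. -/
abbrev TapeGroup : Type := FreeGroup Bool × FreeGroup Bool

/-- The free generator `false` of `FreeGroup Bool`. -/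
abbrev genX : FreeGroup Bool := FreeGroup.of false

/-- The free generator `true` of `FreeGroup Bool`. -/
abbrev genY : FreeGroup Bool := FreeGroup.of true

/-- The automorphism `(g, h) ↦ (swap h, g)`. -/
def twist : TapeGroup ≃* TapeGroup :=
  MulEquiv.prodComm.trans
    (MulEquiv.prodCongr (FreeGroup.freeGroupCongr boolNot) (MulEquiv.refl _))

theorem twist_apply (q : TapeGroup) :
    twist q = (FreeGroup.freeGroupCongr boolNot q.2, q.1) := rfl

/-- Left multiplication on countably many copies of a group. -/
def mulLeftProd {G : Type*} [Group G] : G →* Perm (G × ℕ) where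
  toFun g := prodCongr (Equiv.mulLeft g) (Equiv.refl ℕ)
  map_one' := by ext1 p; simp
  map_mul' g h := by ext1 p; simp [Prod.map]

@[simp]
theorem mulLeftProd_apply {G : Type*} [Group G] (g : G) (p : G × ℕ) :
    mulLeftProd g p = (g * p.1, p.2) := rfl

/-- The permutations acting on the distinguished fibre as the left multiplication by `q`, paired
with `q`. -/
def valued : Submonoid (Perm ((TapeGroup × ℕ) × Bool × Bool) × TapeGroup) where
  carrier := {p | ∀ q n, p.1 ((q, n), false, false) = ((p.2 * q, n), false, false)}
  one_mem' := by simp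
  mul_mem' := by
    rintro ⟨g, q⟩ ⟨g', q'⟩ h h'
    simp only [Set.mem_ofPred_eq] at h h' ⊢
    simp [h, h', mul_assoc]

theorem zpow_injective_of_hom {G : Type*} [Group G] (f : G →* Multiplicative ℤ) {g : G}
    (h : f g ≠ 1) : Function.Injective fun k : ℤ => g ^ k := by
  intro k l hkl
  have h1 := congrArg (fun x => (f x).toAdd) hkl
  simp only [map_zpow, toAdd_zpow, smul_eq_mul] at h1
  exact mul_right_cancel₀ (by simpa using h) h1

/-- The total exponent of a pair of words. -/
def tapeWeight : TapeGroup →* Multiplicative ℤ :=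
  MonoidHom.coprod (FreeGroup.lift fun _ => Multiplicative.ofAdd 1)
    (FreeGroup.lift fun _ => Multiplicative.ofAdd 1)

theorem exists_valued_rep :
    ∃ (x t : Perm ((TapeGroup × ℕ) × Bool × Bool)),
      x * t * (t * x) * (x * t) * (t * x) ^ 3 = 1 ∧
      ((x * t) ^ 2, (genX, 1)) ∈ valued ∧
      ∀ h q, (h, q) ∈ valued → (t * h * t⁻¹, twist q) ∈ valued := by
  have hw : tapeWeight (genX⁻¹, genX⁻¹ ^ 4) ≠ 1 := by
    simp only [tapeWeight, MonoidHom.coprod_apply, map_inv, map_pow, FreeGroup.lift_apply_of]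
    decide
  have hw' : tapeWeight (1, genX) ≠ 1 := by
    simp only [tapeWeight, MonoidHom.coprod_apply, map_one, FreeGroup.lift_apply_of]
    decide
  have : Countable TapeGroup := by
    have : Countable (FreeGroup Bool) := by
      unfold FreeGroup
      infer_instance
    infer_instance
  obtain ⟨σ, hσ⟩ := exists_conj_mulLeft (G := TapeGroup) _ _ (zpow_injective_of_hom _ hw)
    (zpow_injective_of_hom _ hw')
  set α : Perm (TapeGroup × ℕ) := mulLeftProd (genX, 1) with hα
  set β : Perm (TapeGroup × ℕ) := mulLeftProd (1, genX) with hβ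
  set θ : Perm (TapeGroup × ℕ) := prodCongr twist.toEquiv (Equiv.refl ℕ) with hθ
  obtain ⟨a, b, t, h1, h2, h3, h4⟩ := exists_perm_rep (α := α) (β := β) (θ := θ) (σ := σ)
    (by
      rw [hα, hβ, Commute, SemiconjBy, ← map_mul, ← map_mul]
      simp)
    (by
      ext1 p
      simp [hα, hβ, hθ, twist_apply])
    (by
      rw [hα, hβ, ← map_inv, ← map_pow, ← map_inv, ← map_mul]
      ext1 p
      have := hσ p.1 p.2
      simpa using this)
  have hb : t * (a * t⁻¹) = b := by rw [← mul_assoc, h1]; group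
  refine ⟨a * t⁻¹, t, by simpa [hb] using h2, ?_, fun h q hq => ?_⟩
  · intro q n
    have := h3 (q, n)
    simpa [hα] using this
  · intro q' n
    have h5 : t⁻¹ ((q', n), false, false) = ((twist.symm q', n), false, false) := by
      rw [Perm.inv_eq_iff_eq, h4]
      simp [hθ]
    have h6 := hq (twist.symm q') n
    simp only at h6 ⊢
    rw [Perm.mul_apply, Perm.mul_apply, h5, h6, h4]
    simp [hθ]

theorem valued_unique {h : Perm ((TapeGroup × ℕ) × Bool × Bool)} {q q' : TapeGroup}
    (hq : (h, q) ∈ valued) (hq' : (h, q') ∈ valued) : q = q' := by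
  have h1 := (hq 1 0).symm.trans (hq' 1 0)
  simpa using h1

/-- The valued permutations that are trivial or have positive weight. -/
def positiveValued : Submonoid (Perm ((TapeGroup × ℕ) × Bool × Bool)) where
  carrier := {h | ∃ q, (h, q) ∈ valued ∧ (h = 1 ∨ 1 ≤ (tapeWeight q).toAdd)}
  one_mem' := ⟨1, valued.one_mem, Or.inl rfl⟩
  mul_mem' := by
    rintro h h' ⟨q, hq, hw⟩ ⟨q', hq', hw'⟩
    refine ⟨q * q', valued.mul_mem hq hq', ?_⟩
    rw [map_mul, toAdd_mul]
    rcases hw with rfl | hw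
    · rw [valued_unique hq valued.one_mem]
      simpa using hw'
    rcases hw' with rfl | hw'
    · rw [valued_unique hq' valued.one_mem]
      simpa using Or.inr hw
    · right
      omega

theorem positiveValued_conical {h h' : Perm ((TapeGroup × ℕ) × Bool × Bool)}
    (hh : h ∈ positiveValued) (hh' : h' ∈ positiveValued) (e : h * h' = 1) : h = 1 := by
  obtain ⟨q, hq, hw⟩ := hh
  obtain ⟨q', hq', hw'⟩ := hh'
  have h1 : q * q' = 1 := valued_unique (h := 1) (by rw [← e]; exact valued.mul_mem hq hq')
    valued.one_mem
  rcases hw with rfl | hw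
  · rfl
  rcases hw' with rfl | hw'
  · simpa using e
  have h2 := congrArg (fun z => (tapeWeight z).toAdd) h1
  simp only [map_mul, toAdd_mul, map_one, toAdd_one] at h2
  omega

end MonomialPerm

/-! ### Group elements encoding an affine machine -/

namespace AffineRule

variable {G H : Type*} [Group G] [Group H]

/-- The four group elements that generate the tapes, for `i = 0, 1, 2, 3`. -/
def tapeElt (t x : G) (i : ℕ) : G := t ^ i * (x * t) ^ 2 * (t ^ i)⁻¹

/-- The group element of a labelled edge, the vertices being recorded as powers of `e`. -/
def edgeElt (e : G) (p : ℤ × G × ℤ) : G := e ^ p.1 * p.2.1 * e ^ (-p.2.2)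

/-- The graph that spells two copies of a sequence of numbers. -/
def copyEdges (A : ℕ → G) : List (ℤ × G × ℤ) := [(1, A 0, 0), (0, A 1 * A 2, 0), (0, A 3, 1)]

/-- The vertex of a state, the final state `f` being at `0`. -/
def stateVertex (f s : ℕ) : ℤ := 2 * ((s : ℤ) - f)

/-- The vertex of a rule. -/
def ruleVertex (i : AffineRule) : ℤ := 2 * (i.code : ℤ) + 1

/-- The edges through the vertex of a rule. -/
def ruleEdges (f : ℕ) (A : ℕ → G) (i : AffineRule) : List (ℤ × G × ℤ) :=
  [(stateVertex f i.src, A 3 * A 2 ^ i.r * A 1 ^ i.β, ruleVertex i),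
    (ruleVertex i, A 2 ^ i.p * A 1 ^ i.α, ruleVertex i),
    (ruleVertex i, A 0, stateVertex f i.dst)]

/-- The graph that spells the runs of the machine with rules `T`. -/
def runEdges (T : List AffineRule) (f : ℕ) (A : ℕ → G) : List (ℤ × G × ℤ) :=
  T.flatMap (ruleEdges f A)

/-- The generators of the submonoid that simulates the machine with rules `T`. -/
def machineElts (T : List AffineRule) (f : ℕ) (t x e₁ e₂ E : G) : List G :=
  (copyEdges (tapeElt t x)).map (edgeElt e₁) ++ [E] ++
    (runEdges T f (tapeElt t x)).map fun p => E⁻¹ * (edgeElt e₂ p)⁻¹ * E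

/-- The element whose membership encodes that the machine halts on input `N`. -/
def inputElt (f s N : ℕ) (t x e₁ e₂ E : G) : G :=
  e₁ * tapeElt t x 1 ^ N * tapeElt t x 0 * e₂ ^ (-stateVertex f s) * E

theorem map_tapeElt (φ : G →* H) (t x : G) (i : ℕ) :
    φ (tapeElt t x i) = tapeElt (φ t) (φ x) i := by
  simp [tapeElt]

theorem map_machineElts (φ : G →* H) (T : List AffineRule) (f : ℕ) (t x e₁ e₂ E : G) :
    (machineElts T f t x e₁ e₂ E).map φ =
      machineElts T f (φ t) (φ x) (φ e₁) (φ e₂) (φ E) := by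
  simp [machineElts, copyEdges, runEdges, ruleEdges, edgeElt, map_tapeElt, List.map_flatMap]

theorem map_inputElt (φ : G →* H) (f s N : ℕ) (t x e₁ e₂ E : G) :
    φ (inputElt f s N t x e₁ e₂ E) = inputElt f s N (φ t) (φ x) (φ e₁) (φ e₂) (φ E) := by
  simp [inputElt, map_tapeElt]

/-- The submonoid generated by a graph. -/
def edgeMonoid (e : G) (K : List (ℤ × G × ℤ)) : Submonoid G :=
  Submonoid.closure {g | ∃ p ∈ K, g = edgeElt e p}

theorem edge_mul_mem {e : G} {K : List (ℤ × G × ℤ)} {i j : ℤ} {w m : G} (h : (i, w, j) ∈ K)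
    (hm : e ^ j * m ∈ edgeMonoid e K) : e ^ i * (w * m) ∈ edgeMonoid e K := by
  have h1 : edgeElt e (i, w, j) ∈ edgeMonoid e K := Submonoid.subset_closure ⟨_, h, rfl⟩
  have h2 := mul_mem h1 hm
  convert h2 using 1
  simp [edgeElt, mul_assoc]

theorem edge_pow_mul_mem {e : G} {K : List (ℤ × G × ℤ)} {i : ℤ} {w m : G} (h : (i, w, i) ∈ K)
    (hm : e ^ i * m ∈ edgeMonoid e K) (n : ℕ) : e ^ i * (w ^ n * m) ∈ edgeMonoid e K := by
  induction n with
  | zero => simpa using hm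
  | succ n ih =>
    rw [pow_succ', mul_assoc]
    exact edge_mul_mem h ih

theorem exists_run_of_reach {T : List AffineRule} {f : ℕ} {A : ℕ → G} {e₁ e₂ : G}
    (h01 : Commute (A 0) (A 1)) (h12 : Commute (A 1) (A 2)) (h23 : Commute (A 2) (A 3))
    {c : ℕ × ℕ} (h : Reach T c (f, 0)) :
    ∃ l, e₂ ^ stateVertex f c.1 * l ∈ edgeMonoid e₂ (runEdges T f A) ∧
      e₁ * (A 1 ^ c.2 * A 0 * l) ∈ edgeMonoid e₁ (copyEdges A) := by
  induction h using Relation.ReflTransGen.head_induction_on with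
  | refl =>
    refine ⟨1, by simp [stateVertex], ?_⟩
    have := edge_mul_mem (e := e₁) (K := copyEdges A) (i := 1) (w := A 0) (j := 0) (m := 1)
      (by simp [copyEdges]) (by simp)
    simpa using this
  | head hcd _ ih =>
    obtain ⟨l, hl, hk⟩ := ih
    obtain ⟨i, hi, q, rfl, rfl⟩ := hcd
    have hmem : ∀ p ∈ ruleEdges f A i, p ∈ runEdges T f A :=
      fun p hp => List.mem_flatMap.2 ⟨i, hi, hp⟩
    simp only [ruleEdges, List.mem_cons, List.not_mem_nil, or_false, forall_eq_or_imp,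
      forall_eq] at hmem
    obtain ⟨m1, m2, m3⟩ := hmem
    refine ⟨A 3 * A 2 ^ i.r * A 1 ^ i.β * ((A 2 ^ i.p * A 1 ^ i.α) ^ q * (A 0 * l)),
      edge_mul_mem m1 (edge_pow_mul_mem m2 (edge_mul_mem m3 hl) q), ?_⟩
    have h3 : e₁ ^ (0 : ℤ) * (A 3 * (A 1 ^ (i.α * q + i.β) * A 0 * l)) ∈
        edgeMonoid e₁ (copyEdges A) :=
      edge_mul_mem (j := 1) (by simp [copyEdges]) (by simpa using hk)
    have h4 := edge_mul_mem (i := 1) (w := A 0) (by simp [copyEdges])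
      (edge_pow_mul_mem (w := A 1 * A 2) (by simp [copyEdges]) h3 (i.p * q + i.r))
    convert h4 using 1
    have e1 : (A 2 ^ i.p * A 1 ^ i.α) ^ q = A 2 ^ (i.p * q) * A 1 ^ (i.α * q) := by
      rw [(h12.symm.pow_pow _ _).mul_pow, ← pow_mul, ← pow_mul]
    have e2 : A 1 ^ i.β * A 2 ^ (i.p * q) = A 2 ^ (i.p * q) * A 1 ^ i.β :=
      (h12.pow_pow _ _).eq
    have e3 : A 3 * A 2 ^ (i.p * q + i.r) = A 2 ^ (i.p * q + i.r) * A 3 :=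
      (h23.symm.pow_right _).eq
    have e4 : A 1 ^ (i.p * q + i.r) * A 0 = A 0 * A 1 ^ (i.p * q + i.r) :=
      (h01.symm.pow_left _).eq
    rw [h12.mul_pow, zpow_one, e1]
    congr 1
    calc A 1 ^ (i.p * q + i.r) * A 0 * (A 3 * A 2 ^ i.r * A 1 ^ i.β *
          (A 2 ^ (i.p * q) * A 1 ^ (i.α * q) * (A 0 * l)))
        = A 1 ^ (i.p * q + i.r) * A 0 * (A 3 * A 2 ^ i.r * (A 1 ^ i.β * A 2 ^ (i.p * q)) *
          A 1 ^ (i.α * q) * (A 0 * l)) := by simp only [mul_assoc]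
      _ = A 1 ^ (i.p * q + i.r) * A 0 * (A 3 * A 2 ^ (i.p * q + i.r) *
          A 1 ^ (i.α * q + i.β) * (A 0 * l)) := by
        rw [e2, add_comm (i.p * q), add_comm (i.α * q), pow_add (A 2), pow_add (A 1) i.β]
        simp only [mul_assoc]
      _ = _ := by
        rw [e3, e4]
        simp only [mul_assoc]

theorem inv_mem_closure_machineElts {T : List AffineRule} {f : ℕ} {t x e₁ e₂ E m : G}
    (hm : m ∈ edgeMonoid e₂ (runEdges T f (tapeElt t x))) :
    E⁻¹ * m⁻¹ * E ∈ Submonoid.closure {g | g ∈ machineElts T f t x e₁ e₂ E} := by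
  induction hm using Submonoid.closure_induction with
  | mem g hg =>
    obtain ⟨p, hp, rfl⟩ := hg
    refine Submonoid.subset_closure ?_
    simp only [machineElts, Set.mem_ofPred_eq, List.mem_append, List.mem_map]
    exact Or.inr ⟨p, hp, rfl⟩
  | one => simp
  | mul g h _ _ ihg ihh =>
    convert mul_mem ihh ihg using 1
    group

theorem tapeElt_succ_eq (t x : G) (i : ℕ) :
    tapeElt t x (i + 1) = MulAut.conj t (tapeElt t x i) := by
  simp only [tapeElt, MulAut.conj_apply, pow_succ' t, mul_inv_rev, mul_assoc]

theorem commute_tapeElt {t x : G}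
    (hr : x * t * (t * x) * (x * t) * (t * x) ^ 3 = 1) (i : ℕ) :
    Commute (tapeElt t x i) (tapeElt t x (i + 1)) := by
  induction i with
  | zero =>
    have e0 : tapeElt t x 0 = (x * t) ^ 2 := by simp [tapeElt]
    have e1 : tapeElt t x 1 = (t * x) ^ 2 := by
      simp only [tapeElt, pow_one, pow_two]
      group
    rw [zero_add, e0, e1]
    generalize x * t = a at *
    generalize t * x = b at *
    have h1 : (a * b) ^ 2 = (b ^ 2)⁻¹ := by
      rw [eq_inv_iff_mul_eq_one, ← hr]
      simp only [pow_succ, pow_zero, one_mul, mul_assoc]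
    have h2 : Commute (a * b) (b ^ 2) := by
      rw [← Commute.inv_right_iff, ← h1]
      exact Commute.self_pow _ _
    have h3 : Commute a (b ^ 2) := by
      have := h2.mul_left (Commute.inv_left_iff.2 (Commute.self_pow b 2))
      simpa using this
    exact h3.pow_left 2
  | succ i ih =>
    rw [tapeElt_succ_eq t x (i + 1), tapeElt_succ_eq t x i, Commute, SemiconjBy, ← map_mul,
      ← map_mul, ← tapeElt_succ_eq t x i, ih.eq]

/-- If the machine reaches the final state, then the input element is in the submonoid. -/
theorem inputElt_mem {T : List AffineRule} {f s N : ℕ} {t x : G} (e₁ e₂ E : G)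
    (hr : x * t * (t * x) * (x * t) * (t * x) ^ 3 = 1) (h : Reach T (s, N) (f, 0)) :
    inputElt f s N t x e₁ e₂ E ∈
      Submonoid.closure {g | g ∈ machineElts T f t x e₁ e₂ E} := by
  have hc := commute_tapeElt hr
  obtain ⟨l, hl, hk⟩ := exists_run_of_reach (e₁ := e₁) (e₂ := e₂) (hc 0) (hc 1) (hc 2) h
  have h1 := inv_mem_closure_machineElts (e₁ := e₁) (E := E) hl
  have h2 : edgeMonoid e₁ (copyEdges (tapeElt t x)) ≤
      Submonoid.closure {g | g ∈ machineElts T f t x e₁ e₂ E} := by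
    refine Submonoid.closure_mono ?_
    rintro _ ⟨p, hp, rfl⟩
    simp only [machineElts, Set.mem_ofPred_eq, List.mem_append, List.mem_map]
    exact Or.inl (Or.inl ⟨p, hp, rfl⟩)
  have h3 : E ∈ Submonoid.closure {g | g ∈ machineElts T f t x e₁ e₂ E} :=
    Submonoid.subset_closure (by simp [machineElts])
  convert mul_mem (mul_mem (h2 hk) h3) h1 using 1
  simp [inputElt, mul_assoc]

end AffineRule

/-! ### Submonoids of wreath products -/

namespace RegularWreathProduct

variable {D Q : Type*} [Group D] [Group Q]

/-- The inclusion of the factor over the identity in the base of a wreath product. -/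
noncomputable def base : D →* D ≀ᵣ Q where
  toFun d := ⟨open Classical in fun q => if q = 1 then d else 1, 1⟩
  map_one' := by ext <;> simp
  map_mul' d d' := by
    ext q
    · by_cases h : q = 1 <;> simp [h]
    · simp

@[simp]
theorem base_right (d : D) : (base d : D ≀ᵣ Q).right = 1 := rfl

@[simp]
theorem base_left_one (d : D) : (base d : D ≀ᵣ Q).left 1 = d :=
  if_pos rfl

theorem base_left_of_ne (d : D) {q : Q} (h : q ≠ 1) : (base d : D ≀ᵣ Q).left q = 1 :=
  if_neg h

end RegularWreathProduct

namespace AffineRule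

open RegularWreathProduct

/-- Paths in a labelled graph. -/
inductive EdgePath {D : Type*} [Group D] (K : List (ℤ × D × ℤ)) : ℤ → D → ℤ → Prop
  | nil (i : ℤ) : EdgePath K i 1 i
  | cons {i j k : ℤ} {w v : D} : (i, w, j) ∈ K → EdgePath K j v k → EdgePath K i (w * v) k

/-- Apply a function to the labels of the edges. -/
def mapEdges {D D' : Type*} (φ : D → D') (K : List (ℤ × D × ℤ)) : List (ℤ × D' × ℤ) :=
  K.map fun p => (p.1, φ p.2.1, p.2.2)

variable {D Q : Type*} [Group D] [Group Q]

theorem edgeElt_right (ε : Q) (i j : ℤ) (w : D) :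
    (edgeElt (inl ε : D ≀ᵣ Q) (i, base w, j)).right = ε ^ (i - j) := by
  simp only [edgeElt, ← map_zpow, mul_right, right_inl, base_right, mul_one, sub_eq_add_neg,
    zpow_add]

theorem edgeElt_left (ε : Q) (i j : ℤ) (w : D) (q : Q) :
    (edgeElt (inl ε : D ≀ᵣ Q) (i, base w, j)).left q =
      (base w : D ≀ᵣ Q).left (ε ^ (-i) * q) := by
  simp only [edgeElt, ← map_zpow, mul_left, Pi.mul_apply, left_inl, right_inl, Pi.one_apply,
    one_mul, mul_one]
  rw [zpow_neg]

theorem edgeElt_left_self (ε : Q) (i j : ℤ) (w : D) :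
    (edgeElt (inl ε : D ≀ᵣ Q) (i, base w, j)).left (ε ^ i) = w := by
  rw [edgeElt_left, ← zpow_add]
  simp

theorem edgeElt_left_of_ne (ε : Q) (i j : ℤ) (w : D) {q : Q} (h : q ≠ ε ^ i) :
    (edgeElt (inl ε : D ≀ᵣ Q) (i, base w, j)).left q = 1 := by
  rw [edgeElt_left, base_left_of_ne]
  rintro h1
  rw [zpow_neg, inv_mul_eq_one] at h1
  exact h h1.symm

/-- An element of the submonoid of a graph is trivial, or is a single path, or has at least two
nontrivial coordinates. -/
theorem edgeMonoid_cases {N : Submonoid D} (hN : ∀ a ∈ N, ∀ b ∈ N, a * b = 1 → a = 1) {ε : Q}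
    (hε : Function.Injective fun k : ℤ => ε ^ k) {K : List (ℤ × D × ℤ)}
    (hK : ∀ p ∈ K, p.2.1 ∈ N ∧ p.2.1 ≠ 1) {m : D ≀ᵣ Q}
    (hm : m ∈ edgeMonoid (inl ε) (mapEdges base K)) :
    (∀ q, m.left q ∈ N) ∧ (∀ q, m.left q ≠ 1 → ∃ k : ℤ, q = ε ^ k) ∧
      (∃ k : ℤ, m.right = ε ^ k) ∧
      (m = 1 ∨ (∃ i w j, EdgePath K i w j ∧ w ≠ 1 ∧ m = edgeElt (inl ε) (i, base w, j)) ∨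
        ∃ q q', q ≠ q' ∧ m.left q ≠ 1 ∧ m.left q' ≠ 1) := by
  induction hm using Submonoid.closure_induction_left with
  | one =>
    exact ⟨fun q => N.one_mem, fun q h => absurd rfl h, ⟨0, by simp⟩, Or.inl rfl⟩
  | mul_left g hg m _ ih =>
    obtain ⟨_, hg, rfl⟩ := hg
    obtain ⟨⟨i, w, j⟩, hp, rfl⟩ := List.mem_map.1 hg
    obtain ⟨hwN, hw1⟩ := hK _ hp
    simp only at hwN hw1
    obtain ⟨ih1, ih2, ⟨k, ih3⟩, ih4⟩ := ih
    have hleft : ∀ q, (edgeElt (inl ε : D ≀ᵣ Q) (i, base w, j) * m).left q =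
        (edgeElt (inl ε : D ≀ᵣ Q) (i, base w, j)).left q * m.left (ε ^ (j - i) * q) := by
      intro q
      rw [mul_left, Pi.mul_apply, edgeElt_right, ← zpow_neg, neg_sub]
    have hgN : ∀ q, (edgeElt (inl ε : D ≀ᵣ Q) (i, base w, j)).left q ∈ N := by
      intro q
      by_cases hq : q = ε ^ i
      · rw [hq, edgeElt_left_self]
        exact hwN
      · rw [edgeElt_left_of_ne _ _ _ _ hq]
        exact N.one_mem
    have hne1 : (edgeElt (inl ε : D ≀ᵣ Q) (i, base w, j) * m).left (ε ^ i) ≠ 1 := by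
      intro h
      rw [hleft] at h
      have h2 := hN _ (hgN _) _ (ih1 _) h
      rw [edgeElt_left_self] at h2
      exact hw1 h2
    have hne2 : ∀ q, m.left q ≠ 1 →
        (edgeElt (inl ε : D ≀ᵣ Q) (i, base w, j) * m).left (ε ^ (i - j) * q) ≠ 1 := by
      intro q hq h
      rw [hleft] at h
      have h2 := hN _ (hgN _) _ (ih1 _) h
      rw [h2, one_mul, ← mul_assoc, ← zpow_add] at h
      apply hq
      simpa using h
    refine ⟨fun q => ?_, fun q h => ?_, ⟨i - j + k, ?_⟩, Or.inr ?_⟩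
    · rw [hleft]
      exact N.mul_mem (hgN q) (ih1 _)
    · by_cases hq : q = ε ^ i
      · exact ⟨i, hq⟩
      · rw [hleft, edgeElt_left_of_ne _ _ _ _ hq, one_mul] at h
        obtain ⟨k, hk⟩ := ih2 _ h
        refine ⟨i - j + k, ?_⟩
        rw [zpow_add, ← hk, ← mul_assoc, ← zpow_add]
        simp
    · rw [mul_right, edgeElt_right, ih3, zpow_add]
    · rcases ih4 with rfl | ⟨i', v, k', hv, hv1, rfl⟩ | ⟨q, q', hqq, hq, hq'⟩
      · exact Or.inl ⟨i, w, j, by simpa using EdgePath.cons hp (EdgePath.nil j), hw1, by simp⟩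
      · by_cases hj : j = i'
        · subst hj
          refine Or.inl ⟨i, w * v, k', EdgePath.cons hp hv, fun h => ?_, ?_⟩
          · have hvN := ih1 (ε ^ j)
            rw [edgeElt_left_self] at hvN
            exact hw1 (hN _ hwN _ hvN h)
          · simp [edgeElt, mul_assoc]
        · refine Or.inr ⟨ε ^ i, ε ^ (i - j) * ε ^ i', ?_, hne1, hne2 _ ?_⟩
          · rw [← zpow_add]
            intro h
            have := hε h
            omega
          · rwa [edgeElt_left_self]
      · exact Or.inr ⟨_, _, fun h => hqq (mul_left_cancel h), hne2 _ hq, hne2 _ hq'⟩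

/-- The grading group for the two graphs. -/
abbrev GraphGrading : Type := Multiplicative (ℤ × ℤ)

/-- The grading of the first graph. -/
def grading₁ : GraphGrading := Multiplicative.ofAdd (1, 0)

/-- The grading of the second graph. -/
def grading₂ : GraphGrading := Multiplicative.ofAdd (0, 1)

theorem grading_eq_iff {i j k l : ℤ} :
    grading₁ ^ i * grading₂ ^ j = grading₁ ^ k * grading₂ ^ l ↔ i = k ∧ j = l := by
  have h : ∀ i j : ℤ, grading₁ ^ i * grading₂ ^ j = Multiplicative.ofAdd (i, j) := by
    intro i j
    simp [grading₁, grading₂, ← ofAdd_zsmul, ← ofAdd_add]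
  rw [h, h, Multiplicative.ofAdd.injective.eq_iff, Prod.mk.injEq]

theorem grading₁_injective : Function.Injective fun k : ℤ => grading₁ ^ k := by
  intro k l h
  have := grading_eq_iff (i := k) (j := 0) (k := l) (l := 0)
  simp only [zpow_zero, mul_one] at this
  exact (this.1 h).1

theorem grading₂_injective : Function.Injective fun k : ℤ => grading₂ ^ k := by
  intro k l h
  have := grading_eq_iff (i := 0) (j := k) (k := 0) (l := l)
  simp only [zpow_zero, one_mul] at this
  exact (this.1 h).2

theorem exists_edgePath {N : Submonoid D} (hN : ∀ a ∈ N, ∀ b ∈ N, a * b = 1 → a = 1)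
    {K L : List (ℤ × D × ℤ)} (hK : ∀ p ∈ K, p.2.1 ∈ N ∧ p.2.1 ≠ 1)
    (hL : ∀ p ∈ L, p.2.1 ∈ N ∧ p.2.1 ≠ 1) {g : D} {h : ℤ} (hh : h ≠ 0)
    {k l : D ≀ᵣ GraphGrading}
    (hk : k ∈ edgeMonoid (inl grading₁) (mapEdges base K))
    (hl : l ∈ edgeMonoid (inl grading₂) (mapEdges base L))
    (e : inl grading₁ * base g * inl grading₂ ^ (-h) * l = k) :
    ∃ v w, EdgePath K 1 v 0 ∧ EdgePath L h w 0 ∧ v = g * w := by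
  obtain ⟨-, hk2, ⟨k', hk3⟩, hk4⟩ := edgeMonoid_cases hN grading₁_injective hK hk
  obtain ⟨-, hl2, ⟨l', hl3⟩, hl4⟩ := edgeMonoid_cases hN grading₂_injective hL hl
  have hright : grading₁ ^ (1 : ℤ) * grading₂ ^ (-h + l') = grading₁ ^ k' * grading₂ ^ (0 : ℤ) := by
    have h1 := congrArg RegularWreathProduct.right e
    simp only [← map_zpow, mul_right, right_inl, base_right, mul_one, hk3, hl3] at h1
    rw [zpow_add, zpow_one, ← mul_assoc, h1, zpow_zero, mul_one]
  rw [grading_eq_iff] at hright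
  obtain ⟨rfl, hl'⟩ := hright
  obtain rfl : l' = h := by omega
  have hleft : ∀ q, k.left q = (base g : D ≀ᵣ GraphGrading).left (grading₁⁻¹ * q) *
      l.left (grading₂ ^ l' * (grading₁⁻¹ * q)) := by
    intro q
    rw [← e]
    simp only [← map_zpow, mul_left, Pi.mul_apply, left_inl, right_inl, Pi.one_apply, one_mul,
      base_right, mul_assoc, inv_one, ← zpow_neg, neg_neg]
  have hlsupp : ∀ q, l.left q ≠ 1 → q = grading₂ ^ l' := by
    intro q hq
    obtain ⟨n, rfl⟩ := hl2 q hq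
    by_contra hne
    have h1 := hleft (grading₁ * grading₂ ^ (n - l'))
    have h2 : grading₂ ^ l' * (grading₁⁻¹ * (grading₁ * grading₂ ^ (n - l'))) = grading₂ ^ n := by
      rw [inv_mul_cancel_left, ← zpow_add]
      congr 1
      omega
    rw [h2, inv_mul_cancel_left, base_left_of_ne, one_mul] at h1
    · rw [← h1] at hq
      obtain ⟨i, hi⟩ := hk2 _ hq
      have h3 : grading₁ ^ (1 : ℤ) * grading₂ ^ (n - l') = grading₁ ^ i * grading₂ ^ (0 : ℤ) := by
        simpa using hi
      rw [grading_eq_iff] at h3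
      apply hne
      rw [show n = l' by omega]
    · intro h3
      have h4 : grading₂ ^ (n - l') = grading₂ ^ (0 : ℤ) := by simpa using h3
      have h5 : n - l' = 0 := grading₂_injective h4
      apply hne
      rw [show n = l' by omega]
  rcases hl4 with rfl | ⟨i, w, j, hw, hw1, rfl⟩ | ⟨q, q', hqq, hq, hq'⟩
  · exfalso
    have : l' = 0 := grading₂_injective (by simpa using hl3.symm)
    exact hh this
  swap
  · exact absurd ((hlsupp q hq).trans (hlsupp q' hq').symm) hqq
  obtain rfl : i = l' := grading₂_injective (hlsupp _ (by rwa [edgeElt_left_self]))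
  rw [edgeElt_right] at hl3
  obtain rfl : j = 0 := by
    have : i - j = i := grading₂_injective hl3
    omega
  have hke : k = edgeElt (inl grading₁) (1, base (g * w), 0) := by
    rw [← e]
    simp [edgeElt, mul_assoc]
  have hksupp : ∀ q, k.left q ≠ 1 → q = grading₁ ^ (1 : ℤ) := by
    intro q hq
    by_contra hne
    rw [hke, edgeElt_left_of_ne _ _ _ _ hne] at hq
    exact hq rfl
  rcases hk4 with rfl | ⟨i', v, j, hv, hv1, hk5⟩ | ⟨q, q', hqq, hq, hq'⟩
  · exfalso
    have : (1 : ℤ) = 0 := grading₁_injective (by simpa using hk3.symm)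
    omega
  swap
  · exact absurd ((hksupp q hq).trans (hksupp q' hq').symm) hqq
  obtain rfl : i' = 1 := by
    have := hksupp (grading₁ ^ i') (by rw [hk5, edgeElt_left_self]; exact hv1)
    exact grading₁_injective this
  obtain rfl : j = 0 := by
    rw [hk5, edgeElt_right] at hk3
    have : 1 - j = 1 := grading₁_injective hk3
    omega
  refine ⟨v, w, hv, hw, ?_⟩
  have h1 := congrArg (fun z => z.left (grading₁ ^ (1 : ℤ))) (hk5.symm.trans hke)
  simpa only [edgeElt_left_self] using h1

theorem exists_of_base_mul_inl_mem {K L : Set D} {g : D}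
    (h : (base g * inl (Multiplicative.ofAdd 1) : D ≀ᵣ Multiplicative ℤ) ∈
      Submonoid.closure (base '' K ∪ {inl (Multiplicative.ofAdd 1)} ∪
        (fun l => (inl (Multiplicative.ofAdd 1))⁻¹ * (base l)⁻¹ *
          inl (Multiplicative.ofAdd 1)) '' L)) :
    ∃ k ∈ Submonoid.closure K, ∃ l ∈ Submonoid.closure L, g * l = k := by
  have key : ∀ m : D ≀ᵣ Multiplicative ℤ, m ∈ Submonoid.closure (base '' K ∪
      {inl (Multiplicative.ofAdd 1)} ∪ (fun l => (inl (Multiplicative.ofAdd 1))⁻¹ * (base l)⁻¹ *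
          inl (Multiplicative.ofAdd 1)) '' L) →
      (m.right.toAdd = 0 ∧ m.left 1 ∈ Submonoid.closure K ∧
        (m.left (Multiplicative.ofAdd (-1)))⁻¹ ∈ Submonoid.closure L) ∨
      (m.right.toAdd = 1 ∧ ∃ k ∈ Submonoid.closure K, ∃ l ∈ Submonoid.closure L,
        m.left 1 * l = k) ∨ 2 ≤ m.right.toAdd := by
    intro m hm
    induction hm using Submonoid.closure_induction_left with
    | one => left; simp
    | mul_left x hx m _ ih =>
      rcases hx with (⟨k, hk, rfl⟩ | rfl) | ⟨l, hl, rfl⟩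
      · have hk' := Submonoid.subset_closure hk
        have h1 : (base k * m).left (Multiplicative.ofAdd (-1)) =
            m.left (Multiplicative.ofAdd (-1)) := by
          rw [mul_left, Pi.mul_apply, base_left_of_ne _ (by decide)]
          simp
        have h2 : (base k * m).left 1 = k * m.left 1 := by simp
        rw [h1, h2]
        simp only [mul_right, base_right, one_mul]
        rcases ih with ⟨h0, h3, h4⟩ | ⟨h0, k', hk'', l, hl, e⟩ | h0
        · exact Or.inl ⟨h0, mul_mem hk' h3, h4⟩
        · exact Or.inr (Or.inl ⟨h0, k * k', mul_mem hk' hk'', l, hl, by rw [mul_assoc, e]⟩)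
        · exact Or.inr (Or.inr h0)
      · have h2 : (inl (Multiplicative.ofAdd 1) * m : D ≀ᵣ Multiplicative ℤ).left 1 =
            m.left (Multiplicative.ofAdd (-1)) := by simp
        rw [h2]
        simp only [mul_right, right_inl, toAdd_mul, toAdd_ofAdd]
        rcases ih with ⟨h0, h3, h4⟩ | ⟨h0, -⟩ | h0
        · exact Or.inr (Or.inl ⟨by omega, 1, one_mem _, _, h4, by simp⟩)
        · right; right; omega
        · right; right; omega
      · have hl' := Submonoid.subset_closure hl
        have h1 : ((inl (Multiplicative.ofAdd 1))⁻¹ * (base l)⁻¹ *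
            inl (Multiplicative.ofAdd 1) * m).left (Multiplicative.ofAdd (-1)) =
            l⁻¹ * m.left (Multiplicative.ofAdd (-1)) := by
          simp [← map_inv, ← ofAdd_neg, ← ofAdd_add]
        have h2 : ((inl (Multiplicative.ofAdd 1))⁻¹ * (base l)⁻¹ *
            inl (Multiplicative.ofAdd 1) * m).left 1 = m.left 1 := by
          simp [← map_inv, base_left_of_ne, ← ofAdd_neg, ← ofAdd_add]
        rw [h1, h2]
        simp only [mul_right, inv_right, right_inl, base_right, toAdd_mul, toAdd_inv,
          toAdd_ofAdd, toAdd_one]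
        rcases ih with ⟨h0, h3, h4⟩ | ⟨h0, h3⟩ | h0
        · refine Or.inl ⟨by omega, h3, ?_⟩
          rw [mul_inv_rev, inv_inv]
          exact mul_mem h4 hl'
        · exact Or.inr (Or.inl ⟨by omega, h3⟩)
        · right; right; omega
  rcases key _ h with ⟨h0, -⟩ | ⟨-, k, hk, l, hl, e⟩ | h0
  · simp at h0
  · exact ⟨k, hk, l, hl, by simpa using e⟩
  · simp at h0

end AffineRule

/-! ### Decoding the paths -/

theorem FreeGroup.map_of_prod_injective {ι : Type*} :
    Function.Injective fun l : List ι => (l.map FreeGroup.of).prod := by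
  classical
  have h1 : ∀ l : List ι, (l.map FreeGroup.of).prod = FreeGroup.mk (l.map fun i => (i, true)) := by
    intro l
    induction l with
    | nil => rfl
    | cons i l ih => rw [List.map_cons, List.prod_cons, ih]; rfl
  have h2 : ∀ l : List ι, FreeGroup.reduce (l.map fun i => (i, true)) =
      l.map fun i => (i, true) := by
    intro l
    refine FreeGroup.IsReduced.reduce_eq ?_
    rw [FreeGroup.IsReduced, List.isChain_map]
    exact (List.pairwise_of_forall fun _ _ _ => rfl).isChain
  intro l l' h
  have h3 := congrArg FreeGroup.toWord ((h1 l).symm.trans (h.trans (h1 l')))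
  rw [FreeGroup.toWord_mk, FreeGroup.toWord_mk, h2, h2] at h3
  exact List.map_injective_iff.2 (fun a b hab => congrArg Prod.fst hab) h3

namespace AffineRule

open MonomialPerm

/-- The word `P ^ u * R * P ^ v₁ * R * P ^ v₂ * ⋯`. -/
def spell {G : Type*} [Group G] (P R : G) (u : ℕ) (us : List ℕ) : G :=
  P ^ u * (us.map fun v => R * P ^ v).prod

theorem spell_succ {G : Type*} [Group G] (P R : G) (u : ℕ) (us : List ℕ) :
    spell P R (u + 1) us = P * spell P R u us := by
  rw [spell, pow_succ', mul_assoc, spell]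

theorem spell_zero_cons {G : Type*} [Group G] (P R : G) (u : ℕ) (us : List ℕ) :
    spell P R 0 (u :: us) = R * spell P R u us := by
  simp [spell, mul_assoc]

theorem spell_inj {p r : Bool} (hpr : p ≠ r) {u u' : ℕ} {us us' : List ℕ}
    (h : spell (FreeGroup.of p) (FreeGroup.of r) u us =
      spell (FreeGroup.of p) (FreeGroup.of r) u' us') : u = u' ∧ us = us' := by
  have hw : ∀ u us, spell (FreeGroup.of p) (FreeGroup.of r) u us =
      ((List.replicate u p ++ us.flatMap fun v => r :: List.replicate v p).map
        FreeGroup.of).prod := by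
    intro u us
    rw [spell, List.map_append, List.prod_append, List.map_replicate, List.prod_replicate]
    congr 1
    induction us with
    | nil => simp
    | cons v us ih => simp [ih, mul_assoc]
  rw [hw, hw] at h
  have h1 := FreeGroup.map_of_prod_injective h
  clear h hw
  induction us generalizing u us' u' with
  | nil =>
    induction u generalizing u' with
    | zero =>
      rcases u' with _ | u'
      · rcases us' with _ | ⟨v', us'⟩ <;> simp_all
      · simp [List.replicate_succ] at h1
    | succ u ih =>
      rcases u' with _ | u'
      · rcases us' with _ | ⟨v', us'⟩
        · simp [List.replicate_succ] at h1
        · simp [List.replicate_succ, hpr] at h1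
      · have := @ih u' (by simpa [List.replicate_succ] using h1)
        exact ⟨by omega, this.2⟩
  | cons v us ih' =>
    induction u generalizing u' with
    | zero =>
      rcases u' with _ | u'
      · rcases us' with _ | ⟨v', us'⟩
        · simp at h1
        · have := @ih' v v' us' (by simpa using h1)
          simp [this.1, this.2]
      · simp [List.replicate_succ, hpr.symm] at h1
    | succ u ih =>
      rcases u' with _ | u'
      · rcases us' with _ | ⟨v', us'⟩
        · simp [List.replicate_succ] at h1
        · simp [List.replicate_succ, hpr] at h1
      · have := @ih u' (by simpa [List.replicate_succ] using h1)
        exact ⟨by omega, this.2⟩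

/-- The values of the tape elements. -/
def tapeValue (i : ℕ) : TapeGroup := twist^[i] (genX, 1)

theorem tapeValue_zero : tapeValue 0 = (genX, 1) := rfl

theorem tapeValue_one : tapeValue 1 = (1, genX) := by
  simp [tapeValue, twist_apply]

theorem tapeValue_two : tapeValue 2 = (genY, 1) := by
  simp [tapeValue, twist_apply]

theorem tapeValue_three : tapeValue 3 = (1, genY) := by
  simp [tapeValue, twist_apply]

/-- The runs of the machine with rules `T` that end in the state `f`, with the list of the pairs
of numbers before and after each step. The numbers are not required to match. -/
inductive Run (T : List AffineRule) (f : ℕ) : ℕ → List (ℕ × ℕ) → Prop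
  | nil : Run T f f []
  | cons {i : AffineRule} {L : List (ℕ × ℕ)} : i ∈ T → (q : ℕ) → Run T f i.dst L →
      Run T f i.src ((i.p * q + i.r, i.α * q + i.β) :: L)

/-- The value of a run. -/
def runValue (L : List (ℕ × ℕ)) : TapeGroup :=
  ((L.map fun z => genY ^ z.1 * genX).prod, (L.map fun z => genY * genX ^ z.2).prod)

theorem runValue_cons (m n : ℕ) (L : List (ℕ × ℕ)) :
    runValue ((m, n) :: L) = (genY ^ m * genX, genY * genX ^ n) * runValue L := by
  simp [runValue]

theorem copyEdges_path {i j : ℤ} {v : TapeGroup} (h : EdgePath (copyEdges tapeValue) i v j)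
    (hj : j = 0) :
    (i = 0 → ∃ u us, v = (spell genY genX u us, spell genX genY u us)) ∧
      (i = 1 → ∃ u us, v = (genX * spell genY genX u us, spell genX genY u us)) := by
  induction h with
  | nil i =>
    refine ⟨fun _ => ⟨0, [], Prod.ext (by simp [spell]) (by simp [spell])⟩, fun h => by omega⟩
  | cons he _ ih =>
    obtain ⟨ih0, ih1⟩ := ih hj
    simp only [copyEdges, List.mem_cons, Prod.mk.injEq, List.not_mem_nil, or_false] at he
    rcases he with ⟨rfl, rfl, rfl⟩ | ⟨rfl, rfl, rfl⟩ | ⟨rfl, rfl, rfl⟩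
    · obtain ⟨u, us, rfl⟩ := ih0 rfl
      refine ⟨fun h => by omega, fun _ => ⟨u, us, by simp [tapeValue_zero]⟩⟩
    · obtain ⟨u, us, rfl⟩ := ih0 rfl
      refine ⟨fun _ => ⟨u + 1, us, ?_⟩, fun h => by omega⟩
      simp [tapeValue_one, tapeValue_two, spell_succ]
    · obtain ⟨u, us, rfl⟩ := ih1 rfl
      refine ⟨fun _ => ⟨0, u :: us, ?_⟩, fun h => by omega⟩
      simp [tapeValue_three, spell_zero_cons]

theorem stateVertex_inj {f s s' : ℕ} (h : stateVertex f s = stateVertex f s') : s = s' := by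
  unfold stateVertex at h
  omega

theorem ruleVertex_inj {i i' : AffineRule} (h : ruleVertex i = ruleVertex i') : i = i' := by
  unfold ruleVertex at h
  exact code_injective (by omega)

theorem stateVertex_ne_ruleVertex {f s : ℕ} {i : AffineRule} :
    stateVertex f s ≠ ruleVertex i := by
  unfold stateVertex ruleVertex
  omega

theorem runEdges_path {T : List AffineRule} {f : ℕ} {i j : ℤ} {w : TapeGroup}
    (h : EdgePath (runEdges T f tapeValue) i w j) (hj : j = 0) :
    (∀ s, i = stateVertex f s → ∃ L, Run T f s L ∧ w = runValue L) ∧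
      (∀ z, i = ruleVertex z → ∃ q L, Run T f z.dst L ∧
        w = (genY ^ (z.p * q) * genX, genX ^ (z.α * q)) * runValue L) := by
  induction h with
  | nil i =>
    refine ⟨fun s hs => ?_, fun z hz => ?_⟩
    · obtain rfl : s = f := by unfold stateVertex at hs; omega
      exact ⟨[], Run.nil, Prod.ext (by simp [runValue]) (by simp [runValue])⟩
    · unfold ruleVertex at hz
      omega
  | cons he _ ih =>
    obtain ⟨ihs, ihr⟩ := ih hj
    obtain ⟨z, hz, he⟩ := List.mem_flatMap.1 he
    simp only [ruleEdges, List.mem_cons, Prod.mk.injEq, List.not_mem_nil, or_false] at he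
    rcases he with ⟨rfl, rfl, rfl⟩ | ⟨rfl, rfl, rfl⟩ | ⟨rfl, rfl, rfl⟩
    · refine ⟨fun s hs => ?_, fun z' hz' => absurd hz' stateVertex_ne_ruleVertex⟩
      obtain rfl := stateVertex_inj hs
      obtain ⟨q, L, hL, rfl⟩ := ihr z rfl
      refine ⟨_, Run.cons hz q hL, ?_⟩
      rw [runValue_cons, tapeValue_one, tapeValue_two, tapeValue_three, ← mul_assoc]
      simp [pow_add, mul_assoc, add_comm (z.p * q), add_comm (z.α * q)]
    · refine ⟨fun s hs => absurd hs.symm stateVertex_ne_ruleVertex, fun z' hz' => ?_⟩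
      obtain rfl := ruleVertex_inj hz'
      obtain ⟨q, L, hL, rfl⟩ := ihr z rfl
      refine ⟨q + 1, L, hL, ?_⟩
      rw [tapeValue_one, tapeValue_two, ← mul_assoc]
      simp [pow_add, mul_assoc, mul_add, add_comm (z.p * q), add_comm (z.α * q)]
    · refine ⟨fun s hs => absurd hs.symm stateVertex_ne_ruleVertex, fun z' hz' => ?_⟩
      obtain rfl := ruleVertex_inj hz'
      obtain ⟨L, hL, rfl⟩ := ihs _ rfl
      exact ⟨0, L, hL, by simp [tapeValue_zero]⟩

theorem reach_of_run {T : List AffineRule} {f s : ℕ} {L : List (ℕ × ℕ)} (h : Run T f s L) {N : ℕ}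
    (hL : L.map Prod.fst ++ [0] = N :: L.map Prod.snd) : Reach T (s, N) (f, 0) := by
  induction h generalizing N with
  | nil =>
    obtain rfl : 0 = N := by simpa using hL
    exact Relation.ReflTransGen.refl
  | cons hi q _ ih =>
    simp only [List.map_cons, List.cons_append, List.cons.injEq] at hL
    obtain ⟨rfl, hL⟩ := hL
    exact Relation.ReflTransGen.head ⟨_, hi, q, rfl, rfl⟩ (ih hL)

theorem reach_of_paths {T : List AffineRule} {f s N : ℕ} {v w : TapeGroup}
    (hv : EdgePath (copyEdges tapeValue) 1 v 0)
    (hw : EdgePath (runEdges T f tapeValue) (stateVertex f s) w 0)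
    (e : v = tapeValue 1 ^ N * tapeValue 0 * w) : Reach T (s, N) (f, 0) := by
  obtain ⟨u, us, rfl⟩ := (copyEdges_path hv rfl).2 rfl
  obtain ⟨L, hL, rfl⟩ := (runEdges_path hw rfl).1 s rfl
  rw [tapeValue_zero, tapeValue_one, Prod.ext_iff] at e
  simp only [runValue, Prod.fst_mul, Prod.snd_mul, Prod.pow_fst, Prod.pow_snd, one_pow, one_mul,
    mul_one, mul_right_inj] at e
  obtain ⟨e1, e2⟩ := e
  have h2 : spell genX genY u us = spell genX genY N (L.map Prod.snd) := by
    rw [e2, spell, List.map_map]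
    rfl
  obtain ⟨rfl, rfl⟩ := spell_inj (by decide) h2
  have h1 : ∀ (L : List (ℕ × ℕ)) n ns, n :: ns = L.map Prod.fst ++ [0] →
      (L.map fun z => genY ^ z.1 * genX).prod = spell genY genX n ns := by
    intro L
    induction L with
    | nil =>
      intro n ns h
      simp only [List.map_nil, List.nil_append, List.cons.injEq] at h
      simp [spell, h.1, h.2]
    | cons z L ih =>
      intro n ns h
      simp only [List.map_cons, List.cons_append, List.cons.injEq] at h
      obtain ⟨rfl, h⟩ := h
      rcases ns with _ | ⟨n, ns⟩
      · simp at h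
      · rw [List.map_cons, List.prod_cons, ih n ns h]
        simp [spell, mul_assoc]
  obtain ⟨n, ns, hn⟩ : ∃ n ns, n :: ns = L.map Prod.fst ++ [0] := by
    rcases L.map Prod.fst with _ | ⟨n, ns⟩
    · exact ⟨_, _, rfl⟩
    · exact ⟨_, _, rfl⟩
  rw [h1 L n ns hn] at e1
  obtain ⟨rfl, rfl⟩ := spell_inj (by decide) e1
  exact reach_of_run hL hn.symm

end AffineRule

namespace AffineRule

open RegularWreathProduct MonomialPerm

theorem mapEdges_copyEdges {D D' : Type*} [Group D] [Group D'] (φ : D →* D') (A : ℕ → D) :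
    mapEdges φ (copyEdges A) = copyEdges fun i => φ (A i) := by
  simp [mapEdges, copyEdges]

theorem mapEdges_runEdges {D D' : Type*} [Group D] [Group D'] (φ : D →* D') (A : ℕ → D)
    (T : List AffineRule) (f : ℕ) :
    mapEdges φ (runEdges T f A) = runEdges T f fun i => φ (A i) := by
  simp only [mapEdges, runEdges, List.map_flatMap]
  congr 1
  funext i
  simp [ruleEdges]

theorem EdgePath.map {D D' : Type*} [Group D] [Group D'] (φ : D →* D') {K : List (ℤ × D × ℤ)}
    {i j : ℤ} {v : D} (h : EdgePath K i v j) : EdgePath (mapEdges φ K) i (φ v) j := by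
  induction h with
  | nil i => rw [map_one]; exact EdgePath.nil i
  | cons he _ ih =>
    rw [map_mul]
    exact EdgePath.cons (List.mem_map.2 ⟨_, he, rfl⟩) ih

theorem EdgePath.exists_of_map {D D' : Type*} [Group D] [Group D'] (φ : D →* D')
    {K : List (ℤ × D × ℤ)} {i j : ℤ} {v : D'} (h : EdgePath (mapEdges φ K) i v j) :
    ∃ u, EdgePath K i u j ∧ φ u = v := by
  induction h with
  | nil i => exact ⟨1, EdgePath.nil i, map_one φ⟩
  | cons he _ ih =>
    obtain ⟨u, hu, rfl⟩ := ih
    obtain ⟨⟨i, w, j⟩, hp, he⟩ := List.mem_map.1 he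
    simp only [Prod.mk.injEq] at he
    obtain ⟨rfl, rfl, rfl⟩ := he
    exact ⟨_, EdgePath.cons hp hu, map_mul _ _ _⟩

theorem EdgePath.mem {D : Type*} [Group D] {V : Submonoid D} {K : List (ℤ × D × ℤ)}
    (hK : ∀ p ∈ K, p.2.1 ∈ V) {i j : ℤ} {v : D} (h : EdgePath K i v j) : v ∈ V := by
  induction h with
  | nil i => exact V.one_mem
  | cons he _ ih => exact V.mul_mem (hK _ he) ih

theorem copyEdges_mem {D : Type*} [Group D] {V : Submonoid D} {A : ℕ → D} (hA : ∀ i, A i ∈ V) :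
    ∀ p ∈ copyEdges A, p.2.1 ∈ V := by
  simp [copyEdges, hA, V.mul_mem]

theorem runEdges_mem {D : Type*} [Group D] {V : Submonoid D} {A : ℕ → D} (hA : ∀ i, A i ∈ V)
    (T : List AffineRule) (f : ℕ) : ∀ p ∈ runEdges T f A, p.2.1 ∈ V := by
  intro p hp
  obtain ⟨z, -, hp⟩ := List.mem_flatMap.1 hp
  simp only [ruleEdges, List.mem_cons, List.not_mem_nil, or_false] at hp
  rcases hp with rfl | rfl | rfl <;> simp only
  · exact V.mul_mem (V.mul_mem (hA _) (V.pow_mem (hA _) _)) (V.pow_mem (hA _) _)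
  · exact V.mul_mem (V.pow_mem (hA _) _) (V.pow_mem (hA _) _)
  · exact hA _

theorem mem_positiveValued {h : Equiv.Perm ((TapeGroup × ℕ) × Bool × Bool)} {q : TapeGroup}
    (hq : (h, q) ∈ valued) (hw : 1 ≤ (tapeWeight q).toAdd) : h ∈ positiveValued ∧ h ≠ 1 := by
  refine ⟨⟨q, hq, Or.inr hw⟩, ?_⟩
  rintro rfl
  rw [valued_unique hq valued.one_mem] at hw
  simp at hw

theorem tapeWeight_apply (g h : FreeGroup Bool) :
    (tapeWeight (g, h)).toAdd =
      (FreeGroup.lift (fun _ => Multiplicative.ofAdd (1 : ℤ)) g).toAdd +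
        (FreeGroup.lift (fun _ => Multiplicative.ofAdd (1 : ℤ)) h).toAdd := rfl

theorem copyEdges_weight : ∀ p ∈ copyEdges tapeValue, 1 ≤ (tapeWeight p.2.1).toAdd := by
  simp [copyEdges, tapeValue_zero, tapeValue_one, tapeValue_two, tapeValue_three,
    tapeWeight_apply]

theorem runEdges_weight {T : List AffineRule} (hT : ∀ i ∈ T, 0 < i.p) (f : ℕ) :
    ∀ p ∈ runEdges T f tapeValue, 1 ≤ (tapeWeight p.2.1).toAdd := by
  intro p hp
  obtain ⟨z, hz, hp⟩ := List.mem_flatMap.1 hp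
  have := hT z hz
  simp only [ruleEdges, List.mem_cons, List.not_mem_nil, or_false] at hp
  rcases hp with rfl | rfl | rfl <;>
    simp [tapeValue_zero, tapeValue_one, tapeValue_two, tapeValue_three, tapeWeight_apply] <;>
    omega

/-- There is a group in which membership of the input element in the submonoid of the machine
forces the machine to halt. -/
theorem exists_group_reach {T : List AffineRule} (hT : ∀ i ∈ T, 0 < i.p) {s f : ℕ} (hsf : s ≠ f) :
    ∃ (G : Type) (_ : Group G) (t x e₁ e₂ E : G),
      x * t * (t * x) * (x * t) * (t * x) ^ 3 = 1 ∧
      ∀ N, inputElt f s N t x e₁ e₂ E ∈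
        Submonoid.closure {g | g ∈ machineElts T f t x e₁ e₂ E} → Reach T (s, N) (f, 0) := by
  obtain ⟨x, t, hr, h0, htw⟩ := exists_valued_rep
  have hval : ∀ i, (tapeElt t x i, tapeValue i) ∈ valued := by
    intro i
    induction i with
    | zero =>
      have h : tapeElt t x 0 = (x * t) ^ 2 := by simp [tapeElt]
      rw [h]
      exact h0
    | succ i ih =>
      rw [tapeElt_succ_eq, tapeValue, Function.iterate_succ_apply']
      exact htw _ _ ih
  let A : ℕ → Equiv.Perm ((TapeGroup × ℕ) × Bool × Bool) × TapeGroup :=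
    fun i => (tapeElt t x i, tapeValue i)
  have hlabel : ∀ K : List (ℤ × (Equiv.Perm ((TapeGroup × ℕ) × Bool × Bool) × TapeGroup) × ℤ),
      (∀ p ∈ K, p.2.1 ∈ valued) →
      (∀ p ∈ mapEdges (MonoidHom.snd _ _) K, 1 ≤ (tapeWeight p.2.1).toAdd) →
      ∀ p ∈ mapEdges (MonoidHom.fst _ _) K, p.2.1 ∈ positiveValued ∧ p.2.1 ≠ 1 := by
    intro K hK hw p hp
    obtain ⟨p', hp', rfl⟩ := List.mem_map.1 hp
    exact mem_positiveValued (hK _ hp') (hw _ (List.mem_map.2 ⟨p', hp', rfl⟩))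
  have hK := hlabel (copyEdges A) (copyEdges_mem hval)
    (by rw [mapEdges_copyEdges]; exact copyEdges_weight)
  have hL := hlabel (runEdges T f A) (runEdges_mem hval T f)
    (by rw [mapEdges_runEdges]; exact runEdges_weight hT f)
  rw [mapEdges_copyEdges] at hK
  rw [mapEdges_runEdges] at hL
  change ∀ p ∈ copyEdges (tapeElt t x), _ at hK
  change ∀ p ∈ runEdges T f (tapeElt t x), _ at hL
  let D := Equiv.Perm ((TapeGroup × ℕ) × Bool × Bool)
  let ι₁ : D →* D ≀ᵣ GraphGrading := base
  let ι₂ : D ≀ᵣ GraphGrading →* (D ≀ᵣ GraphGrading) ≀ᵣ Multiplicative ℤ := base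
  refine ⟨(D ≀ᵣ GraphGrading) ≀ᵣ Multiplicative ℤ, inferInstance, ι₂ (ι₁ t), ι₂ (ι₁ x),
    ι₂ (inl grading₁), ι₂ (inl grading₂), inl (Multiplicative.ofAdd 1), ?_, fun N hN => ?_⟩
  · simp only [← map_mul, ← map_pow, hr, map_one]
  have hN' : ι₂ (inl grading₁ * ι₁ (tapeElt t x 1) ^ N * ι₁ (tapeElt t x 0) *
      inl grading₂ ^ (-stateVertex f s)) * inl (Multiplicative.ofAdd 1) ∈
      Submonoid.closure (ι₂ '' {g | ∃ p ∈ mapEdges ι₁ (copyEdges (tapeElt t x)),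
          g = edgeElt (inl grading₁) p} ∪ {inl (Multiplicative.ofAdd 1)} ∪
        (fun l => (inl (Multiplicative.ofAdd 1))⁻¹ * (ι₂ l)⁻¹ *
          inl (Multiplicative.ofAdd 1)) '' {g | ∃ p ∈ mapEdges ι₁ (runEdges T f (tapeElt t x)),
          g = edgeElt (inl grading₂) p}) := by
    convert Submonoid.closure_mono ?_ hN using 1
    · simp only [inputElt, map_mul, map_pow, map_zpow, map_tapeElt]
    · have hmap : ∀ (e : D ≀ᵣ GraphGrading) (p : ℤ × D × ℤ),
          edgeElt (ι₂ e) (p.1, ι₂ (ι₁ p.2.1), p.2.2) =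
          ι₂ (edgeElt e (p.1, ι₁ p.2.1, p.2.2)) := by
        intro e p
        simp [edgeElt]
      intro g hg
      have h1 : copyEdges (tapeElt (ι₂ (ι₁ t)) (ι₂ (ι₁ x))) =
          mapEdges ι₂ (mapEdges ι₁ (copyEdges (tapeElt t x))) := by
        simp only [mapEdges_copyEdges, map_tapeElt]
      have h2 : runEdges T f (tapeElt (ι₂ (ι₁ t)) (ι₂ (ι₁ x))) =
          mapEdges ι₂ (mapEdges ι₁ (runEdges T f (tapeElt t x))) := by
        simp only [mapEdges_runEdges, map_tapeElt]
      simp only [machineElts, Set.mem_ofPred_eq, List.mem_append, List.mem_singleton, h1, h2,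
        mapEdges, List.map_map, List.mem_map, Function.comp_def, hmap] at hg
      rcases hg with (⟨p, hp, rfl⟩ | rfl) | ⟨p, hp, rfl⟩
      · exact Or.inl (Or.inl ⟨_, ⟨_, List.mem_map.2 ⟨p, hp, rfl⟩, rfl⟩, rfl⟩)
      · exact Or.inl (Or.inr rfl)
      · exact Or.inr ⟨_, ⟨_, List.mem_map.2 ⟨p, hp, rfl⟩, rfl⟩, rfl⟩
  obtain ⟨k, hk, l, hl, e⟩ := exists_of_base_mul_inl_mem hN'
  have hh : stateVertex f s ≠ 0 := by
    unfold stateVertex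
    omega
  obtain ⟨v, w, hv, hw, hvw⟩ := exists_edgePath
    (fun a ha b hb => positiveValued_conical ha hb) hK hL (h := stateVertex f s)
    (g := tapeElt t x 1 ^ N * tapeElt t x 0) hh hk hl
    (by rw [← e, map_mul, map_pow]; simp only [mul_assoc]; rfl)
  have hv' : EdgePath (mapEdges (MonoidHom.fst _ _) (copyEdges A)) 1 v 0 := by
    rw [mapEdges_copyEdges]
    exact hv
  have hw' : EdgePath (mapEdges (MonoidHom.fst _ _) (runEdges T f A)) (stateVertex f s) w 0 := by
    rw [mapEdges_runEdges]
    exact hw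
  obtain ⟨v₁, hv₁, rfl⟩ := hv'.exists_of_map
  obtain ⟨w₁, hw₁, rfl⟩ := hw'.exists_of_map
  have hv2 := hv₁.map (MonoidHom.snd _ _)
  have hw2 := hw₁.map (MonoidHom.snd _ _)
  rw [mapEdges_copyEdges] at hv2
  rw [mapEdges_runEdges] at hw2
  refine reach_of_paths hv2 hw2
    (valued_unique (h := v₁.1) (hv₁.mem (copyEdges_mem hval)) ?_)
  have h3 : A 1 ^ N * A 0 * w₁ ∈ valued :=
    mul_mem (mul_mem (pow_mem (hval 1) N) (hval 0)) (hw₁.mem (runEdges_mem hval T f))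
  convert h3 using 1
  exact Prod.ext hvw rfl

end AffineRule

/-! ### Encoding a submonoid into a prefix monoid -/

namespace PrefixEncoding

open RegularWreathProduct

theorem prefix_append_cases {α : Type*} {p l l' : List α} (h : p <+: l ++ l') :
    p <+: l ∨ ∃ q, p = l ++ q ∧ q <+: l' := by
  rcases List.prefix_or_prefix_of_prefix h (List.prefix_append l l') with h' | ⟨q, rfl⟩
  · exact Or.inl h'
  · exact Or.inr ⟨q, rfl, (List.prefix_append_right_inj l).1 h⟩

/-- The word that replaces the second generator of the base group. -/
def block : List (Fin 7) := [1, 2, 3, 4, 5, 6]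

/-- The relator of the base group after its first block. -/
def relatorTail : List (Fin 7) :=
  [0, 0] ++ block ++ block ++ [0, 0] ++ block ++ [0] ++ block ++ [0] ++ block

/-- The relator of the base group, as a positive word. -/
def relator : List (Fin 7) := block ++ relatorTail

/-- The images of the five generators of the base group. -/
def baseGen {H : Type*} [Group H] (c : Fin 7 → H) : Fin 5 → H :=
  ![c 0, (block.map c).prod, c 1, c 2, c 3]

/-- A positive word that represents the inverse of the last letter of the relator. -/
def invWord : List (Fin 7) := relatorTail ++ [1, 2, 3, 4, 5]

theorem prod_relator {H : Type*} [Group H] (c : Fin 7 → H) (t x : H) (ht : c 0 = t)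
    (hx : (block.map c).prod = x) :
    (relator.map c).prod = x * t * (t * x) * (x * t) * (t * x) ^ 3 := by
  simp only [relator, relatorTail, List.map_append, List.prod_append, hx, List.map_cons,
    List.map_nil, List.prod_cons, List.prod_nil, ht, pow_succ, pow_zero, one_mul, mul_one,
    mul_assoc]

theorem prod_invWord {H : Type*} [Group H] {c : Fin 7 → H} (hc : (relator.map c).prod = 1) :
    (invWord.map c).prod = (c 6)⁻¹ := by
  rw [eq_inv_iff_mul_eq_one]
  have h : (relatorTail.map c).prod * (block.map c).prod = 1 := by
    rw [relator, List.map_append, List.prod_append] at hc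
    exact mul_eq_one_comm.1 hc
  simpa [invWord, block, mul_assoc] using h

/-- The exponent of the grading of each letter. -/
def letterHeight : Fin 7 → ℤ := ![0, 0, 0, 0, 1, 0, -1]

/-- The total height of a positive word. -/
def height (l : List (Fin 7)) : ℤ := (l.map letterHeight).sum

/-- A positive word all of whose prefixes have nonnegative height. -/
def NonnegHeight (l : List (Fin 7)) : Prop := ∀ p, p <+: l → 0 ≤ height p

theorem height_append (l l' : List (Fin 7)) : height (l ++ l') = height l + height l' := by
  simp [height]

theorem NonnegHeight.append {l l' : List (Fin 7)} (hl : NonnegHeight l) (hl' : NonnegHeight l') :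
    NonnegHeight (l ++ l') := by
  intro p hp
  rcases prefix_append_cases hp with h | ⟨q, rfl, hq⟩
  · exact hl p h
  · rw [height_append]
    exact add_nonneg (hl l (List.prefix_refl l)) (hl' q hq)

theorem nonnegHeight_of_inits {l : List (Fin 7)} (h : ∀ p ∈ l.inits, 0 ≤ height p) :
    NonnegHeight l :=
  fun p hp => h p (List.mem_inits _ _ |>.2 hp)

/-- A positive word spells an element of the free group on the five generators whenever the
relator is trivial. -/
def Spells (l : List (Fin 7)) (w : FreeGroup (Fin 5)) : Prop :=
  ∀ (H : Type) [Group H] (c : Fin 7 → H), (relator.map c).prod = 1 →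
    (l.map c).prod = FreeGroup.lift (baseGen c) w

/-- Positive words for the inverses of the five generators. -/
def invGenWord : Fin 5 → List (Fin 7) :=
  ![relatorTail.tail ++ block, relatorTail, [2, 3, 4, 5, 6] ++ relatorTail,
    [3, 4, 5, 6] ++ relatorTail ++ [1], [4, 5, 6] ++ relatorTail ++ [1, 2]]

theorem exists_spells (w : FreeGroup (Fin 5)) : ∃ l, NonnegHeight l ∧ Spells l w := by
  induction w using FreeGroup.induction_on with
  | C1 => exact ⟨[], nonnegHeight_of_inits (by decide), fun H _ c _ => by simp⟩
  | of i =>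
    refine ⟨![[0], block, [1], [2], [3]] i, nonnegHeight_of_inits ?_, fun H _ c _ => ?_⟩
    · fin_cases i <;> decide
    · fin_cases i <;> simp [baseGen]
  | inv_of i _ =>
    refine ⟨invGenWord i, nonnegHeight_of_inits ?_, fun H _ c hc => ?_⟩
    · fin_cases i <;> decide
    · rw [map_inv, FreeGroup.lift_apply_of, eq_inv_iff_mul_eq_one]
      have h : ∀ a b : List (Fin 7), relator = a ++ b →
          (b.map c).prod * (a.map c).prod = 1 := by
        intro a b hab
        rw [hab, List.map_append, List.prod_append] at hc
        exact mul_eq_one_comm.1 hc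
      fin_cases i
      · have := h (block ++ [0]) relatorTail.tail rfl
        simpa [invGenWord, baseGen, mul_assoc] using this
      · have := h block relatorTail rfl
        simpa [invGenWord, baseGen, mul_assoc] using this
      · have := h [1] ([2, 3, 4, 5, 6] ++ relatorTail) rfl
        simpa [invGenWord, baseGen, mul_assoc] using this
      · have := h [1, 2] ([3, 4, 5, 6] ++ relatorTail) rfl
        simpa [invGenWord, baseGen, mul_assoc] using this
      · have := h [1, 2, 3] ([4, 5, 6] ++ relatorTail) rfl
        simpa [invGenWord, baseGen, mul_assoc] using this
  | mul w w' hw hw' =>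
    obtain ⟨l, hl, h⟩ := hw
    obtain ⟨l', hl', h'⟩ := hw'
    exact ⟨l ++ l', hl.append hl', fun H _ c hc => by
      rw [List.map_append, List.prod_append, h H c hc, h' H c hc, map_mul]⟩

/-- A positive word for an element of the free group on the five generators. -/
noncomputable def posWord (w : FreeGroup (Fin 5)) : List (Fin 7) := (exists_spells w).choose

theorem nonnegHeight_posWord (w : FreeGroup (Fin 5)) : NonnegHeight (posWord w) :=
  (exists_spells w).choose_spec.1

theorem prod_posWord (w : FreeGroup (Fin 5)) {H : Type} [Group H] {c : Fin 7 → H}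
    (hc : (relator.map c).prod = 1) :
    ((posWord w).map c).prod = FreeGroup.lift (baseGen c) w :=
  (exists_spells w).choose_spec.2 H c hc

/-- A positive word for the conjugate of an element by the last letter of the relator. -/
noncomputable def conjWord (w : FreeGroup (Fin 5)) : List (Fin 7) := invWord ++ posWord w ++ [6]

theorem prod_conjWord (w : FreeGroup (Fin 5)) {H : Type} [Group H] {c : Fin 7 → H}
    (hc : (relator.map c).prod = 1) :
    ((conjWord w).map c).prod = (c 6)⁻¹ * FreeGroup.lift (baseGen c) w * c 6 := by
  simp [conjWord, prod_invWord hc, prod_posWord w hc, mul_assoc]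

theorem prod_conjWord_append_inv (w : FreeGroup (Fin 5)) {H : Type} [Group H] {c : Fin 7 → H}
    (hc : (relator.map c).prod = 1) : ((conjWord w ++ conjWord w⁻¹).map c).prod = 1 := by
  simp [prod_conjWord _ hc, mul_assoc]

/-- The word, with trivial value, whose prefixes represent the conjugates of the elements
of a list. -/
noncomputable def listWord (W : List (FreeGroup (Fin 5))) : List (Fin 7) :=
  W.flatMap fun w => conjWord w ++ conjWord w⁻¹

theorem prod_listWord (W : List (FreeGroup (Fin 5))) {H : Type} [Group H] {c : Fin 7 → H}
    (hc : (relator.map c).prod = 1) : ((listWord W).map c).prod = 1 := by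
  induction W with
  | nil => simp [listWord]
  | cons w W ih =>
    rw [listWord] at ih
    rw [listWord, List.flatMap_cons, List.map_append, List.prod_append, ih, mul_one,
      prod_conjWord_append_inv w hc]

theorem exists_prefix_listWord {W : List (FreeGroup (Fin 5))} {w : FreeGroup (Fin 5)}
    (hw : w ∈ W) : ∃ W', listWord W' ++ conjWord w <+: listWord W := by
  obtain ⟨W₁, W₂, rfl⟩ := List.append_of_mem hw
  exact ⟨W₁, by simp [listWord]⟩

/-! ### The detecting representation -/

section Representation

variable {D : Type} [Group D]

/-- The elements of positive height, together with those of height zero whose component at `1`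
lies in a given submonoid. -/
def detector (M : Submonoid D) : Submonoid (D ≀ᵣ Multiplicative ℤ) where
  carrier := {g | 0 < g.right.toAdd ∨ g.right = 1 ∧ g.left (Multiplicative.ofAdd 1) ∈ M}
  one_mem' := Or.inr ⟨rfl, M.one_mem⟩
  mul_mem' := by
    rintro a b (ha | ⟨ha, ha'⟩) (hb | ⟨hb, hb'⟩)
    · exact Or.inl (by simpa using add_pos ha hb)
    · exact Or.inl (by simpa [hb] using ha)
    · exact Or.inl (by simpa [ha] using hb)
    · exact Or.inr ⟨by simp [ha, hb], by simpa [ha] using M.mul_mem ha' hb'⟩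

theorem mem_detector {M : Submonoid D} {g : D ≀ᵣ Multiplicative ℤ} :
    g ∈ detector M ↔
      0 < g.right.toAdd ∨ g.right = 1 ∧ g.left (Multiplicative.ofAdd 1) ∈ M := Iff.rfl

/-- The element that shifts the grading down. -/
def shift : D ≀ᵣ Multiplicative ℤ := inl (Multiplicative.ofAdd (-1))

theorem conj_shift_mem_detector {M : Submonoid D} {d : D} :
    shift⁻¹ * base d * shift ∈ detector M ↔ d ∈ M := by
  have h : (shift⁻¹ * base d * shift : D ≀ᵣ Multiplicative ℤ).left (Multiplicative.ofAdd 1) =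
      d := by
    rw [shift, ← map_inv]
    simp
  have h' : (shift⁻¹ * base d * shift : D ≀ᵣ Multiplicative ℤ).right = 1 := by
    simp [shift]
  rw [mem_detector, h, h']
  simp

theorem base_mem_detector (M : Submonoid D) (d : D) :
    (base d : D ≀ᵣ Multiplicative ℤ) ∈ detector M :=
  Or.inr ⟨rfl, by rw [base_left_of_ne _ (by decide)]; exact M.one_mem⟩

/-- The images of the letters in the wreath product. -/
noncomputable def rep (t x e₁ e₂ E : D) : Fin 7 → D ≀ᵣ Multiplicative ℤ :=
  ![base t, base e₁, base e₂, base E, shift⁻¹,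
    shift * base ((e₁ * e₂ * E)⁻¹ * x) * shift⁻¹, shift]

variable {t x e₁ e₂ E : D}

theorem prod_block_rep : (block.map (rep t x e₁ e₂ E)).prod = base x := by
  have h : (base x : D ≀ᵣ Multiplicative ℤ) =
      base e₁ * (base e₂ * (base E * base ((e₁ * e₂ * E)⁻¹ * x))) := by
    simp only [← map_mul]
    congr 1
    group
  rw [h]
  simp [block, rep, mul_assoc]

theorem baseGen_rep : baseGen (rep t x e₁ e₂ E) = fun i => base (![t, x, e₁, e₂, E] i) := by
  funext i
  rw [baseGen, prod_block_rep]
  fin_cases i <;> rfl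

theorem lift_baseGen_rep (w : FreeGroup (Fin 5)) :
    FreeGroup.lift (baseGen (rep t x e₁ e₂ E)) w =
      base (FreeGroup.lift ![t, x, e₁, e₂, E] w) := by
  rw [baseGen_rep, ← MonoidHom.comp_apply]
  refine DFunLike.congr_fun (FreeGroup.ext_hom _ _ fun i => ?_) w
  rw [MonoidHom.comp_apply, FreeGroup.lift_apply_of, FreeGroup.lift_apply_of]

theorem prod_relator_rep (hr : x * t * (t * x) * (x * t) * (t * x) ^ 3 = 1) :
    (relator.map (rep t x e₁ e₂ E)).prod = 1 := by
  refine (prod_relator _ (base t) (base x) rfl prod_block_rep).trans ?_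
  simp only [← map_mul, ← map_pow, hr, map_one]

theorem right_rep (l : List (Fin 7)) :
    ((l.map (rep t x e₁ e₂ E)).prod).right = Multiplicative.ofAdd (height l) := by
  induction l with
  | nil => rfl
  | cons i l ih =>
    have h : height (i :: l) = letterHeight i + height l := rfl
    rw [List.map_cons, List.prod_cons, mul_right, ih, h, ofAdd_add]
    congr 1
    fin_cases i <;> simp [rep, letterHeight, shift]

/-- All the prefixes of a positive word have their values in a submonoid. -/
def PrefixesIn {H : Type*} [Group H] (c : Fin 7 → H) (J : Submonoid H) (l : List (Fin 7)) :
    Prop :=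
  ∀ p, p <+: l → (p.map c).prod ∈ J

theorem PrefixesIn.append {H : Type*} [Group H] {c : Fin 7 → H} {J : Submonoid H}
    {l l' : List (Fin 7)} (hl : PrefixesIn c J l) (hl' : PrefixesIn c J l') :
    PrefixesIn c J (l ++ l') := by
  intro p hp
  rcases prefix_append_cases hp with h | ⟨q, rfl, hq⟩
  · exact hl p h
  · rw [List.map_append, List.prod_append]
    exact J.mul_mem (hl l (List.prefix_refl l)) (hl' q hq)

theorem PrefixesIn.snoc {H : Type*} [Group H] {c : Fin 7 → H} {J : Submonoid H}
    {l : List (Fin 7)} (hl : PrefixesIn c J l) {i : Fin 7}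
    (h : ((l ++ [i]).map c).prod ∈ J) : PrefixesIn c J (l ++ [i]) := by
  intro p hp
  rcases List.prefix_concat_iff.1 hp with rfl | h'
  · exact h
  · exact hl p h'

theorem prefixesIn_nil {H : Type*} [Group H] {c : Fin 7 → H} {J : Submonoid H} :
    PrefixesIn c J [] := by
  intro p hp
  rw [List.prefix_nil.1 hp]
  exact J.one_mem

theorem rep_mem_detector (M : Submonoid D) {i : Fin 7} (hi : i ≠ 6) :
    rep t x e₁ e₂ E i ∈ detector M := by
  fin_cases i
  · exact base_mem_detector M _
  · exact base_mem_detector M _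
  · exact base_mem_detector M _
  · exact base_mem_detector M _
  · left
    simp [rep, shift]
  · right
    refine ⟨by simp [rep, shift], ?_⟩
    have h : (rep t x e₁ e₂ E 5).left (Multiplicative.ofAdd 1) = 1 := by
      simp only [rep, shift, ← map_inv, Matrix.cons_val, mul_left, left_inl, right_inl,
        mul_right, Pi.mul_apply, Pi.one_apply, one_mul, mul_one]
      exact base_left_of_ne _ (by decide)
    exact h ▸ M.one_mem
  · exact absurd rfl hi

theorem prefixesIn_of_letters (M : Submonoid D) {l : List (Fin 7)} (hl : ∀ i ∈ l, i ≠ 6) :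
    PrefixesIn (rep t x e₁ e₂ E) (detector M) l := by
  intro p hp
  refine list_prod_mem fun g hg => ?_
  obtain ⟨i, hi, rfl⟩ := List.mem_map.1 hg
  exact rep_mem_detector M (hl i (hp.subset hi))

theorem prefixesIn_block (M : Submonoid D) :
    PrefixesIn (rep t x e₁ e₂ E) (detector M) block := by
  change PrefixesIn _ _ ([1, 2, 3, 4, 5] ++ [6])
  refine (prefixesIn_of_letters M (by decide)).snoc ?_
  exact (prod_block_rep (t := t) (x := x) (e₁ := e₁) (e₂ := e₂) (E := E)) ▸
    base_mem_detector M x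

theorem prefixesIn_relatorTail (M : Submonoid D) :
    PrefixesIn (rep t x e₁ e₂ E) (detector M) relatorTail := by
  have h0 : PrefixesIn (rep t x e₁ e₂ E) (detector M) [0] :=
    prefixesIn_of_letters M (by decide)
  have h00 : PrefixesIn (rep t x e₁ e₂ E) (detector M) [0, 0] :=
    prefixesIn_of_letters M (by decide)
  have hb := prefixesIn_block (t := t) (x := x) (e₁ := e₁) (e₂ := e₂) (E := E) M
  exact (((((((h00.append hb).append hb).append h00).append hb).append h0).append hb).append
    h0).append hb

theorem prefixesIn_relator (M : Submonoid D) :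
    PrefixesIn (rep t x e₁ e₂ E) (detector M) relator :=
  (prefixesIn_block M).append (prefixesIn_relatorTail M)

theorem prefixesIn_invWord (M : Submonoid D) :
    PrefixesIn (rep t x e₁ e₂ E) (detector M) invWord :=
  (prefixesIn_relatorTail M).append (prefixesIn_of_letters M (by decide))

theorem prefixesIn_invWord_append (M : Submonoid D) {l : List (Fin 7)} (hl : NonnegHeight l) :
    PrefixesIn (rep t x e₁ e₂ E) (detector M) (invWord ++ l) := by
  intro p hp
  rcases prefix_append_cases hp with h | ⟨q, rfl, hq⟩
  · exact prefixesIn_invWord M p h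
  · left
    rw [right_rep, height_append, toAdd_ofAdd]
    have h1 : height invWord = 1 := by decide
    have := hl q hq
    omega

theorem prefixesIn_listWord {M : Submonoid D}
    (hr : x * t * (t * x) * (x * t) * (t * x) ^ 3 = 1) {W : List (FreeGroup (Fin 5))}
    (hW : ∀ w ∈ W, FreeGroup.lift ![t, x, e₁, e₂, E] w ∈ M) :
    PrefixesIn (rep t x e₁ e₂ E) (detector M) (listWord W) := by
  have hrel := prod_relator_rep (e₁ := e₁) (e₂ := e₂) (E := E) hr
  induction W with
  | nil => exact prefixesIn_nil
  | cons w W ih =>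
    have h1 : PrefixesIn (rep t x e₁ e₂ E) (detector M) (conjWord w) := by
      refine (prefixesIn_invWord_append M (nonnegHeight_posWord w)).snoc (i := 6) ?_
      rw [← conjWord, prod_conjWord w hrel, lift_baseGen_rep]
      exact conj_shift_mem_detector.2 (hW w List.mem_cons_self)
    have h2 : PrefixesIn (rep t x e₁ e₂ E) (detector M)
        (conjWord w ++ (invWord ++ posWord w⁻¹) ++ [6]) := by
      refine (h1.append (prefixesIn_invWord_append M (nonnegHeight_posWord w⁻¹))).snoc ?_
      rw [List.append_assoc, ← conjWord, prod_conjWord_append_inv w hrel]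
      exact one_mem _
    rw [List.append_assoc, ← conjWord] at h2
    exact h2.append (ih fun w hw => hW w (List.mem_cons_of_mem _ hw))

end Representation

/-! ### The one-relator group -/

/-- The word `v` of the relator `u v⁻¹`. -/
noncomputable def denWord (W : List (FreeGroup (Fin 5))) : List (Fin 7) := listWord W ++ [0]

/-- The word `u` of the relator `u v⁻¹`. -/
noncomputable def numWord (W : List (FreeGroup (Fin 5))) : List (Fin 7) := denWord W ++ relator

/-- The one-relator group attached to a list of generators of a submonoid. -/
abbrev OneRelatorGroup (W : List (FreeGroup (Fin 5))) : Type :=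
  PresentedGroup
    ({((numWord W).map FreeGroup.of).prod * (((denWord W).map FreeGroup.of).prod)⁻¹} :
      Set (FreeGroup (Fin 7)))

variable (W : List (FreeGroup (Fin 5)))

/-- The images of the letters in the one-relator group. -/
def letter (i : Fin 7) : OneRelatorGroup W := PresentedGroup.of i

theorem map_prod_of {H : Type*} [Group H] (φ : FreeGroup (Fin 7) →* H) (l : List (Fin 7)) :
    φ (l.map FreeGroup.of).prod = (l.map fun i => φ (FreeGroup.of i)).prod := by
  rw [map_list_prod, List.map_map]
  rfl

theorem prod_relator_letter : (relator.map (letter W)).prod = 1 := by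
  have h := PresentedGroup.one_of_mem (rels :=
    ({((numWord W).map FreeGroup.of).prod * (((denWord W).map FreeGroup.of).prod)⁻¹} :
      Set (FreeGroup (Fin 7)))) (Set.mem_singleton _)
  rw [map_mul, map_inv, map_prod_of, map_prod_of, mul_inv_eq_one] at h
  change ((numWord W).map (letter W)).prod = ((denWord W).map (letter W)).prod at h
  have h' : ((numWord W).map (letter W)).prod =
      ((denWord W).map (letter W)).prod * (relator.map (letter W)).prod := by
    rw [← List.prod_append, ← List.map_append]
    rfl
  exact mul_eq_left.1 (h'.symm.trans h)

theorem evalGrpWord_append {k : ℕ} {G : Type*} [Group G] (c : Fin k → G)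
    (a b : List (Fin k × Bool)) : evalGrpWord c (a ++ b) = evalGrpWord c a * evalGrpWord c b := by
  simp [evalGrpWord]

theorem evalGrpWord_pos {k : ℕ} {G : Type*} [Group G] (c : Fin k → G) (l : List (Fin k)) :
    evalGrpWord c (l.map fun i => (i, false)) = (l.map c).prod := by
  simp [evalGrpWord, Function.comp_def]

theorem evalGrpWord_neg {k : ℕ} {G : Type*} [Group G] (c : Fin k → G) (l : List (Fin k)) :
    evalGrpWord c (l.reverse.map fun i => (i, true)) = ((l.map c).prod)⁻¹ := by
  simp [evalGrpWord, Function.comp_def, List.prod_inv_reverse]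

theorem map_evalGrpWord {k : ℕ} {G H : Type*} [Group G] [Group H] (φ : G →* H) (c : Fin k → G)
    (l : List (Fin k × Bool)) : φ (evalGrpWord c l) = evalGrpWord (fun i => φ (c i)) l := by
  rw [evalGrpWord, map_list_prod, List.map_map, evalGrpWord]
  congr 2
  funext p
  rcases p with ⟨i, _ | _⟩ <;> simp

theorem prefix_map {α β : Type*} {f : α → β} {p : List β} {l : List α} (h : p <+: l.map f) :
    ∃ q, q <+: l ∧ p = q.map f := by
  obtain ⟨q, hq⟩ := h
  obtain ⟨a, b, rfl, rfl, rfl⟩ := List.map_eq_append_iff.1 hq.symm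
  exact ⟨a, List.prefix_append a b, rfl⟩

/-- The values of the prefixes of `u v⁻¹`, in a group where `u = v`, are among the values
of the prefixes of `u` and of `v`. -/
theorem evalGrpWord_prefix_mem {H : Type*} [Group H] {c : Fin 7 → H} {J : Submonoid H}
    {u v : List (Fin 7)} (huv : (u.map c).prod = (v.map c).prod) (hu : PrefixesIn c J u)
    (hv : PrefixesIn c J v) {p : List (Fin 7 × Bool)} (hp : p <+: relatorWord u v) :
    evalGrpWord c p ∈ J := by
  rcases prefix_append_cases hp with h | ⟨q, rfl, hq⟩
  · obtain ⟨p, hp', rfl⟩ := prefix_map h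
    rw [evalGrpWord_pos]
    exact hu p hp'
  · obtain ⟨q, ⟨q', hq'⟩, rfl⟩ := prefix_map hq
    obtain rfl : v = q'.reverse ++ q.reverse := by
      rw [← List.reverse_append, hq', List.reverse_reverse]
    have hneg := evalGrpWord_neg c q.reverse
    rw [List.reverse_reverse] at hneg
    rw [evalGrpWord_append, evalGrpWord_pos, hneg, huv, List.map_append, List.prod_append,
      mul_inv_cancel_right]
    exact hv _ (List.prefix_append _ _)

theorem mem_prefixMonoid {w : FreeGroup (Fin 5)} (hw : w ∈ W) :
    (letter W 6)⁻¹ * FreeGroup.lift (baseGen (letter W)) w * letter W 6 ∈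
      prefixMonoid (numWord W) (denWord W) := by
  obtain ⟨W', h⟩ := exists_prefix_listWord hw
  refine Submonoid.subset_closure ⟨(listWord W' ++ conjWord w).map fun i => (i, false), ?_, ?_⟩
  · have h' : listWord W' ++ conjWord w <+: numWord W :=
      (h.trans (List.prefix_append _ _)).trans (List.prefix_append _ _)
    exact (h'.map _).trans (List.prefix_append _ _)
  · change _ = evalGrpWord (letter W) _
    rw [evalGrpWord_pos, List.map_append, List.prod_append,
      prod_listWord _ (prod_relator_letter W), one_mul, prod_conjWord _ (prod_relator_letter W)]

variable {D : Type} [Group D] {t x e₁ e₂ E : D}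

theorem lift_mem_closure_of_mem_prefixMonoid {W : List (FreeGroup (Fin 5))}
    (hr : x * t * (t * x) * (x * t) * (t * x) ^ 3 = 1) {w : FreeGroup (Fin 5)}
    (h : (letter W 6)⁻¹ * FreeGroup.lift (baseGen (letter W)) w * letter W 6 ∈
      prefixMonoid (numWord W) (denWord W)) :
    FreeGroup.lift ![t, x, e₁, e₂, E] w ∈
      Submonoid.closure {g | g ∈ W.map (FreeGroup.lift ![t, x, e₁, e₂, E])} := by
  set M := Submonoid.closure {g | g ∈ W.map (FreeGroup.lift ![t, x, e₁, e₂, E])} with hM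
  have hrel := prod_relator_rep (e₁ := e₁) (e₂ := e₂) (E := E) hr
  have heq : ((numWord W).map (rep t x e₁ e₂ E)).prod =
      ((denWord W).map (rep t x e₁ e₂ E)).prod := by
    rw [numWord, List.map_append, List.prod_append, hrel, mul_one]
  let φ : OneRelatorGroup W →* D ≀ᵣ Multiplicative ℤ :=
    PresentedGroup.toGroup (f := rep t x e₁ e₂ E) (by
      intro r hr'
      rw [Set.mem_singleton_iff.1 hr', map_mul, map_inv, map_prod_of, map_prod_of]
      simpa [mul_inv_eq_one] using heq)
  have hφ : ∀ i, φ (letter W i) = rep t x e₁ e₂ E i := fun i => PresentedGroup.toGroup.of _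
  have hneg : PrefixesIn (rep t x e₁ e₂ E) (detector M) (denWord W) :=
    (prefixesIn_listWord hr fun w hw => Submonoid.subset_closure (List.mem_map_of_mem hw)).append
      (prefixesIn_of_letters M (by decide))
  have hpos := hneg.append (prefixesIn_relator M)
  have hle : prefixMonoid (numWord W) (denWord W) ≤ (detector M).comap φ := by
    refine Submonoid.closure_le.2 ?_
    rintro g ⟨p, hp, rfl⟩
    change φ (evalGrpWord (letter W) p) ∈ detector M
    rw [map_evalGrpWord]
    simp only [hφ]
    exact evalGrpWord_prefix_mem heq hpos hneg hp
  have h1 := hle h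
  rw [Submonoid.mem_comap, map_mul, map_mul, map_inv, hφ] at h1
  have h2 : φ (FreeGroup.lift (baseGen (letter W)) w) =
      base (FreeGroup.lift ![t, x, e₁, e₂, E] w) := by
    rw [← prod_posWord w (prod_relator_letter W), map_list_prod, List.map_map, ← lift_baseGen_rep,
      ← prod_posWord w hrel]
    congr 2
    funext i
    exact hφ i
  rw [h2] at h1
  exact conj_shift_mem_detector.1 h1

theorem exists_evalGrpWord {W : List (FreeGroup (Fin 5))} (g : OneRelatorGroup W) :
    ∃ l, evalGrpWord (letter W) l = g := by
  obtain ⟨w, rfl⟩ := PresentedGroup.mk_surjective _ g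
  induction w using FreeGroup.induction_on with
  | C1 => exact ⟨[], by simp [evalGrpWord]⟩
  | of i => exact ⟨[(i, false)], by simp [evalGrpWord]; rfl⟩
  | inv_of i _ => exact ⟨[(i, true)], by simp [evalGrpWord]; rfl⟩
  | mul a b ha hb =>
    obtain ⟨l, hl⟩ := ha
    obtain ⟨l', hl'⟩ := hb
    exact ⟨l ++ l', by rw [evalGrpWord_append, hl, hl', map_mul]⟩

theorem evalGrpWord_iterate {k : ℕ} {G : Type*} [Group G] (c : Fin k → G)
    (a b : List (Fin k × Bool)) (n : ℕ) :
    evalGrpWord c ((fun l => a ++ l)^[n] b) = evalGrpWord c a ^ n * evalGrpWord c b := by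
  induction n with
  | zero => simp
  | succ n ih => rw [Function.iterate_succ_apply', evalGrpWord_append, ih, pow_succ', mul_assoc]

end PrefixEncoding

open PrefixEncoding AffineRule

/-- There exists a one-relator group `G = Gp⟨A | u v⁻¹ = 1⟩`, with `u, v` nonempty
positive words such that `u v⁻¹` is freely reduced (equivalently, the last letters of `u`
and `v` are distinct), whose prefix membership problem is undecidable. -/
theorem exists_quasi_positive_one_relator_group_undecidable_prefix_membership :
    ∃ (k : ℕ) (u v : List (Fin k)),
      u ≠ [] ∧ v ≠ [] ∧ u.getLast? ≠ v.getLast? ∧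
      ¬ ComputablePred fun w : List (Fin k × Bool) =>
        evalGrpWord (fun i => PresentedGroup.of i) w ∈ prefixMonoid u v := by
  obtain ⟨T, s, f, hT, hsf, hund⟩ := exists_affine_machine_undecidable
  obtain ⟨D, hD, t, x, e₁, e₂, E, hr, hD⟩ := exists_group_reach hT hsf
  let a : Fin 5 → FreeGroup (Fin 5) := FreeGroup.of
  let W := machineElts T f (a 0) (a 1) (a 2) (a 3) (a 4)
  let c := letter W
  have key : ∀ N, (c 6)⁻¹ * inputElt f s N (c 0) ((block.map c).prod) (c 1) (c 2) (c 3) * c 6 ∈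
      prefixMonoid (numWord W) (denWord W) ↔ Reach T (s, N) (f, 0) := by
    intro N
    have hψ : FreeGroup.lift (baseGen c) (inputElt f s N (a 0) (a 1) (a 2) (a 3) (a 4)) =
        inputElt f s N (c 0) ((block.map c).prod) (c 1) (c 2) (c 3) := by
      simp [map_inputElt, a, baseGen]
    constructor
    · intro h
      rw [← hψ] at h
      have h' := lift_mem_closure_of_mem_prefixMonoid (e₁ := e₁) (e₂ := e₂) (E := E) hr h
      refine hD N ?_
      rw [map_machineElts, map_inputElt] at h'
      simpa [a] using h'
    · intro h
      have hrel : (block.map c).prod * c 0 * (c 0 * (block.map c).prod) *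
          ((block.map c).prod * c 0) * (c 0 * (block.map c).prod) ^ 3 = 1 := by
        rw [← prod_relator c _ _ rfl rfl]
        exact prod_relator_letter W
      have h1 := inputElt_mem (c 1) (c 2) (c 3) hrel h
      have hle : Submonoid.closure {g | g ∈ machineElts T f (c 0) ((block.map c).prod)
          (c 1) (c 2) (c 3)} ≤
          (prefixMonoid (numWord W) (denWord W)).comap
            (MulAut.conj (c 6)⁻¹).toMonoidHom := by
        refine Submonoid.closure_le.2 fun g hg => ?_
        have hm : machineElts T f (c 0) ((block.map c).prod) (c 1) (c 2) (c 3) =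
            W.map (FreeGroup.lift (baseGen c)) := by
          simp [W, map_machineElts, a, baseGen]
        rw [Set.mem_ofPred_eq, hm] at hg
        obtain ⟨w, hw, rfl⟩ := List.mem_map.1 hg
        simpa using mem_prefixMonoid W hw
      simpa using hle h1
  refine ⟨7, numWord W, denWord W, by simp [numWord, denWord], by simp [denWord], ?_, ?_⟩
  · simp [numWord, denWord, relator, relatorTail, block]
  intro h
  refine hund ?_
  obtain ⟨w₁, hw₁⟩ := exists_evalGrpWord ((c 6)⁻¹ * c 1)
  obtain ⟨w₂, hw₂⟩ := exists_evalGrpWord (tapeElt (c 0) ((block.map c).prod) 1)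
  obtain ⟨w₃, hw₃⟩ := exists_evalGrpWord
    (tapeElt (c 0) ((block.map c).prod) 0 * c 2 ^ (-stateVertex f s) * c 3 * c 6)
  refine ComputablePred.computable_of_manyOneReducible
    (q := fun w : List (Fin 7 × Bool) =>
      evalGrpWord (fun i => PresentedGroup.of i) w ∈ prefixMonoid (numWord W) (denWord W))
    ⟨fun m => w₁ ++ (fun l => w₂ ++ l)^[2 ^ m] w₃, ?_, fun m => ?_⟩ h
  · have hpow : Primrec fun m : ℕ => 2 ^ m := by
      have : Primrec fun m : ℕ => (fun n => 2 * n)^[m] 1 :=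
        Primrec.nat_iterate Primrec.id (Primrec.const 1)
          (Primrec.nat_mul.comp (Primrec.const 2) Primrec.snd).to₂
      refine this.of_eq fun m => ?_
      induction m with
      | zero => rfl
      | succ m ih => rw [Function.iterate_succ_apply', ih, pow_succ']
    exact (Primrec.list_append.comp (Primrec.const w₁) (Primrec.nat_iterate hpow
      (Primrec.const w₃) (Primrec.list_append.comp (Primrec.const w₂) Primrec.snd).to₂)).to_comp
  · refine (key (2 ^ m)).symm.trans ?_
    change _ ↔ evalGrpWord (letter W) _ ∈ _
    rw [evalGrpWord_append, evalGrpWord_iterate, hw₁, hw₂, hw₃, inputElt]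
    simp only [mul_assoc]
end

section
/- Let A be a finite alphabet and q ∈ A⁺ a nonempty positive word such that the natural map from the presented monoid Mon⟨A | q = 1⟩ to the presented group G = Gp⟨A | q = 1⟩ induced by the identity on A is an isomorphism (i.e. the one-relation monoid with this presentation is a group). Let Q be the submonoid of G generated by a finite subset. Then there exist a finite alphabet Y and nonempty positive words u, v ∈ Y⁺ with u v^{-1} freely reduced such that the one-relator group G' = Gp⟨Y | u v^{-1} = 1⟩ is isomorphic to G ∗ ℤ, and decidability of the prefix membership problem of the presentation Gp⟨Y | u v^{-1} = 1⟩ implies decidability of the membership problem for Q in G. -/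
/-- The one-relation monoid `Mon⟨A | u = v⟩` over the alphabet `Fin k`. -/
abbrev OneRelMonoid {k : ℕ} (u v : List (Fin k)) :=
  PresentedMonoid (fun x y : FreeMonoid (Fin k) =>
    x = FreeMonoid.ofList u ∧ y = FreeMonoid.ofList v)

section Words

variable {k : ℕ} {G H : Type*} [Group G] [Group H]

/-- Every prefix of `l`, evaluated along `f` and started at `x`, lies in `N`. -/
def PrefixesIn {α : Type*} (N : Submonoid H) (f : α → H) (x : H) (l : List α) : Prop :=
  ∀ p, p <+: l → x * (p.map f).prod ∈ N

lemma prefixesIn_nil {α : Type*} {N : Submonoid H} {f : α → H} {x : H} (hx : x ∈ N) :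
    PrefixesIn N f x [] := by
  intro p hp
  simpa [List.prefix_nil.1 hp] using hx

lemma PrefixesIn.cons {α : Type*} {N : Submonoid H} {f : α → H} {x : H} {a : α} {l : List α}
    (hx : x ∈ N) (h : PrefixesIn N f (x * f a) l) : PrefixesIn N f x (a :: l) := by
  intro p hp
  rcases List.prefix_cons_iff.1 hp with rfl | ⟨t, rfl, ht⟩
  · simpa using hx
  · simpa [mul_assoc] using h t ht

lemma PrefixesIn.append {α : Type*} {N : Submonoid H} {f : α → H} {x : H} {l₁ l₂ : List α}
    (h₁ : PrefixesIn N f x l₁) (h₂ : PrefixesIn N f (x * (l₁.map f).prod) l₂) :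
    PrefixesIn N f x (l₁ ++ l₂) := by
  induction l₁ generalizing x with
  | nil => simpa using h₂
  | cons a l ih =>
    refine PrefixesIn.cons (by simpa using h₁ [] List.nil_prefix) (ih (fun p hp => ?_) ?_)
    · simpa [mul_assoc] using h₁ (a :: p) (by simpa using hp)
    · simpa [mul_assoc] using h₂

/-- The substitution `aᵢ ↦ t bᵢ`, where `t` is the last letter of the larger alphabet. -/
def pairWord (w : List (Fin k)) : List (Fin (k + 1)) :=
  w.flatMap fun i => [Fin.last k, i.castSucc]

@[simp]
lemma pairWord_cons (i : Fin k) (w : List (Fin k)) :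
    pairWord (i :: w) = Fin.last k :: i.castSucc :: pairWord w := by
  simp [pairWord]

lemma prod_map_pairWord (f : Fin (k + 1) → H) (w : List (Fin k)) :
    ((pairWord w).map f).prod = (w.map fun i => f (Fin.last k) * f i.castSucc).prod := by
  induction w with
  | nil => simp [pairWord]
  | cons i w ih => simp [ih, mul_assoc]

/-- The positive word `t w t⁻¹`, in which `t⁻¹` is spelled `b a⁻¹` for the letter `b = t⁻¹ a` and
a positive spelling `a'` of `a⁻¹`. -/
def conjBlock (a : Fin k) (a' w : List (Fin k)) : List (Fin (k + 1)) :=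
  Fin.last k :: pairWord w ++ a.castSucc :: pairWord a'

/-- The concatenation of the words `t g t⁻¹ · t g⁻¹ t⁻¹` for `g` in a list, where `σ` selects
positive spellings. -/
def stemWord (a : Fin k) (a' : List (Fin k)) (σ : G → List (Fin k)) (L : List G) :
    List (Fin (k + 1)) :=
  L.flatMap fun g => conjBlock a a' (σ g) ++ conjBlock a a' (σ g⁻¹)

section Evaluation

variable {gen : Fin k → G} {ι : G →* H} {f : Fin (k + 1) → H} {a : Fin k} {a' : List (Fin k)}
  {σ : G → List (Fin k)}

lemma prod_map_pairWord_eq (hι : ∀ i, ι (gen i) = f (Fin.last k) * f i.castSucc)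
    (w : List (Fin k)) : ((pairWord w).map f).prod = ι (w.map gen).prod := by
  rw [prod_map_pairWord, map_list_prod, List.map_map]
  congr 1
  exact List.map_congr_left fun i _ => (hι i).symm

lemma prod_map_conjBlock (hι : ∀ i, ι (gen i) = f (Fin.last k) * f i.castSucc)
    (ha : (a'.map gen).prod = (gen a)⁻¹) (w : List (Fin k)) :
    ((conjBlock a a' w).map f).prod =
      f (Fin.last k) * ι (w.map gen).prod * (f (Fin.last k))⁻¹ := by
  have := hι a
  simp [conjBlock, prod_map_pairWord_eq hι, ha, this, mul_assoc]

lemma prod_map_stemWord (hι : ∀ i, ι (gen i) = f (Fin.last k) * f i.castSucc)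
    (ha : (a'.map gen).prod = (gen a)⁻¹) (hσ : ∀ g, ((σ g).map gen).prod = g) (L : List G) :
    ((stemWord a a' σ L).map f).prod = 1 := by
  induction L with
  | nil => simp [stemWord]
  | cons g L ih =>
    simp only [stemWord] at ih ⊢
    simp only [List.flatMap_cons, List.map_append, List.prod_append, ih,
      prod_map_conjBlock hι ha, hσ, map_inv]
    group

lemma exists_prefix_stemWord (hι : ∀ i, ι (gen i) = f (Fin.last k) * f i.castSucc)
    (ha : (a'.map gen).prod = (gen a)⁻¹) (hσ : ∀ g, ((σ g).map gen).prod = g) (L : List G)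
    {g : G} (hg : g ∈ L) :
    ∃ p, p <+: stemWord a a' σ L ∧
      (p.map f).prod = f (Fin.last k) * ι g * (f (Fin.last k))⁻¹ := by
  obtain ⟨s, t, rfl⟩ := List.append_of_mem hg
  refine ⟨stemWord a a' σ s ++ conjBlock a a' (σ g), ?_, ?_⟩
  · simp [stemWord]
  · rw [List.map_append, List.prod_append, prod_map_stemWord hι ha hσ,
      prod_map_conjBlock hι ha, hσ, one_mul]

variable {N : Submonoid H} {Q : Submonoid G}

lemma prefixesIn_pairWord (hι : ∀ i, ι (gen i) = f (Fin.last k) * f i.castSucc)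
    (ht : f (Fin.last k) ∈ N) {x : H} (hx : ∀ g, x * ι g ∈ N) (w : List (Fin k)) :
    PrefixesIn N f x (pairWord w) := by
  induction w generalizing x with
  | nil => exact prefixesIn_nil (by simpa using hx 1)
  | cons i w ih =>
    have hx1 : x ∈ N := by simpa using hx 1
    rw [pairWord_cons]
    refine .cons hx1 (.cons (N.mul_mem hx1 ht) (ih fun g => ?_))
    simpa [hι, mul_assoc] using hx (gen i * g)

lemma prefixesIn_conjBlock (hι : ∀ i, ι (gen i) = f (Fin.last k) * f i.castSucc)
    (hN₀ : ∀ s ∈ Q, ∀ g, f (Fin.last k) * ι s * (f (Fin.last k))⁻¹ * ι g ∈ N)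
    (hN₁ : ∀ g, f (Fin.last k) * ι g ∈ N) {s : G} (hs : s ∈ Q) {w : List (Fin k)}
    (hw : s * (w.map gen).prod ∈ Q) :
    PrefixesIn N f (f (Fin.last k) * ι s * (f (Fin.last k))⁻¹) (conjBlock a a' w) := by
  have ht : f (Fin.last k) ∈ N := by simpa using hN₁ 1
  have hs' := hN₀ s hs 1
  rw [map_one, mul_one] at hs'
  refine .append (.cons hs' (prefixesIn_pairWord hι ht (fun g => ?_) w)) (.cons ?_
    (prefixesIn_pairWord hι ht (fun g => ?_) a'))
  · simpa [mul_assoc] using hN₁ (s * g)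
  · simpa [prod_map_pairWord_eq hι, mul_assoc] using hN₁ (s * (w.map gen).prod)
  · have := hN₀ _ hw (gen a * g)
    rw [map_mul, map_mul, hι a] at this
    simpa [prod_map_pairWord_eq hι, mul_assoc] using this

lemma prefixesIn_stemWord (hι : ∀ i, ι (gen i) = f (Fin.last k) * f i.castSucc)
    (ha : (a'.map gen).prod = (gen a)⁻¹) (hσ : ∀ g, ((σ g).map gen).prod = g)
    (hN₀ : ∀ s ∈ Q, ∀ g, f (Fin.last k) * ι s * (f (Fin.last k))⁻¹ * ι g ∈ N)
    (hN₁ : ∀ g, f (Fin.last k) * ι g ∈ N) {L : List G} (hL : ∀ g ∈ L, g ∈ Q) :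
    PrefixesIn N f 1 (stemWord a a' σ L) := by
  induction L with
  | nil => exact prefixesIn_nil N.one_mem
  | cons g L ih =>
    rw [List.forall_mem_cons] at hL
    have h₁ : PrefixesIn N f 1 (conjBlock a a' (σ g)) := by
      simpa using prefixesIn_conjBlock (a := a) (a' := a') hι hN₀ hN₁ Q.one_mem
        (w := σ g) (by simpa [hσ] using hL.1)
    have h₂ : PrefixesIn N f (f (Fin.last k) * ι g * (f (Fin.last k))⁻¹)
        (conjBlock a a' (σ g⁻¹)) :=
      prefixesIn_conjBlock hι hN₀ hN₁ hL.1 (by simp [hσ])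
    refine PrefixesIn.append (h₁.append (by simpa [prod_map_conjBlock hι ha, hσ] using h₂)) ?_
    have : 1 * ((conjBlock a a' (σ g) ++ conjBlock a a' (σ g⁻¹)).map f).prod = 1 := by
      simp only [List.map_append, List.prod_append, prod_map_conjBlock hι ha, hσ, map_inv]
      group
    rw [this]
    exact ih hL.2

end Evaluation

end Words

section PrefixMonoid

variable {k : ℕ} {H : Type*} [Group H]

lemma evalGrpWord_append (gen : Fin k → H) (u v : List (Fin k × Bool)) :
    evalGrpWord gen (u ++ v) = evalGrpWord gen u * evalGrpWord gen v := by
  simp [evalGrpWord]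

lemma evalGrpWord_positive (gen : Fin k → H) (p : List (Fin k)) :
    evalGrpWord gen (p.map fun i => (i, false)) = (p.map gen).prod := by
  simp [evalGrpWord, Function.comp_def]

lemma evalGrpWord_negative (gen : Fin k → H) (p : List (Fin k)) :
    evalGrpWord gen (p.reverse.map fun i => (i, true)) = ((p.map gen).prod)⁻¹ := by
  simp [evalGrpWord, Function.comp_def, List.prod_inv_reverse]

lemma mk_prod_map_of (rels : Set (FreeGroup (Fin k))) (w : List (Fin k)) :
    PresentedGroup.mk rels (w.map FreeGroup.of).prod =
      (w.map (PresentedGroup.of (rels := rels))).prod := by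
  rw [map_list_prod, List.map_map]
  rfl

lemma lift_prod_map_of (f : Fin k → H) (w : List (Fin k)) :
    FreeGroup.lift f (w.map FreeGroup.of).prod = (w.map f).prod := by
  rw [map_list_prod, List.map_map]
  congr 1
  exact List.map_congr_left fun i _ => FreeGroup.lift_apply_of

lemma prod_map_of_mem_prefixMonoid {u v p : List (Fin k)} (hp : p <+: u) :
    (p.map PresentedGroup.of).prod ∈ prefixMonoid u v := by
  refine Submonoid.subset_closure ⟨p.map fun i => (i, false), ?_, (evalGrpWord_positive _ _).symm⟩
  exact (hp.map _).trans (List.prefix_append _ _)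

lemma prod_map_of_eq (u v : List (Fin k)) :
    (u.map (PresentedGroup.of (rels :=
      {(u.map FreeGroup.of).prod * ((v.map FreeGroup.of).prod)⁻¹}))).prod =
      (v.map PresentedGroup.of).prod := by
  rw [← mul_inv_eq_one, ← mk_prod_map_of, ← mk_prod_map_of, ← map_inv, ← map_mul]
  exact PresentedGroup.one_of_mem rfl

/-- Since `u = v` in the group, the prefixes of the relator `u v⁻¹` evaluate to prefixes of `u` and
of `v`. -/
lemma prefixMonoid_le_comap {u v : List (Fin k)} {N : Submonoid H}
    (φ : PresentedGroup ({(u.map FreeGroup.of).prod * ((v.map FreeGroup.of).prod)⁻¹} :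
      Set (FreeGroup (Fin k))) →* H)
    (hu : PrefixesIn N (fun i => φ (PresentedGroup.of i)) 1 u)
    (hv : PrefixesIn N (fun i => φ (PresentedGroup.of i)) 1 v) :
    prefixMonoid u v ≤ N.comap φ := by
  have key : ∀ {w p : List (Fin k)}, PrefixesIn N (fun i => φ (PresentedGroup.of i)) 1 w →
      p <+: w → φ (p.map PresentedGroup.of).prod ∈ N := by
    intro w p hw hp
    rw [map_list_prod, List.map_map]
    simpa [Function.comp_def] using hw p hp
  rw [prefixMonoid, Submonoid.closure_le]
  rintro _ ⟨p, hp, rfl⟩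
  rw [SetLike.mem_coe, Submonoid.mem_comap]
  rcases List.prefix_or_prefix_of_prefix hp (List.prefix_append _ _) with h | ⟨t, rfl⟩
  · obtain ⟨p', hp', rfl⟩ := List.prefix_map_iff.1 h
    rw [evalGrpWord_positive]
    exact key hu hp'
  · rw [relatorWord, List.prefix_append_right_inj] at hp
    obtain ⟨p', hp', rfl⟩ := List.prefix_map_iff.1 hp
    obtain ⟨s, hs⟩ := hp'
    have hv' : v = s.reverse ++ p'.reverse := by
      rw [← List.reverse_append, hs, List.reverse_reverse]
    have hneg := evalGrpWord_negative (PresentedGroup.of (rels :=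
      {(u.map FreeGroup.of).prod * ((v.map FreeGroup.of).prod)⁻¹})) p'.reverse
    rw [List.reverse_reverse] at hneg
    have hprod : (v.map (PresentedGroup.of (rels :=
      {(u.map FreeGroup.of).prod * ((v.map FreeGroup.of).prod)⁻¹}))).prod =
        (s.reverse.map PresentedGroup.of).prod * (p'.reverse.map PresentedGroup.of).prod := by
      rw [← List.prod_append, ← List.map_append, ← hv']
    rw [evalGrpWord_append, evalGrpWord_positive, hneg, prod_map_of_eq, hprod,
      mul_inv_cancel_right]
    exact key hv ⟨_, hv'.symm⟩

end PrefixMonoid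

section Wreath

open RegularWreathProduct

variable {G : Type*} [Group G]

/-- The generator of the infinite cyclic top group of the wreath product. -/
def wreathShift (G : Type*) [Group G] : G ≀ᵣ Multiplicative ℤ :=
  ⟨1, Multiplicative.ofAdd 1⟩

open Classical in
/-- The embedding of `G` into the coordinate at the identity of the base group. -/
def wreathBase (G : Type*) [Group G] : G →* G ≀ᵣ Multiplicative ℤ where
  toFun g := ⟨Pi.mulSingle 1 g, 1⟩
  map_one' := by ext <;> simp
  map_mul' g h := by
    ext
    · simp [Pi.mulSingle_mul]
    · simp

/-- The elements of nonnegative height whose coordinate at height one lies in `Q` if their height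
is zero. -/
def heightSubmonoid (Q : Submonoid G) : Submonoid (G ≀ᵣ Multiplicative ℤ) where
  carrier := {x | 1 ≤ x.right ∧ (x.right = 1 → x.left (Multiplicative.ofAdd 1) ∈ Q)}
  one_mem' := ⟨le_rfl, fun _ => Q.one_mem⟩
  mul_mem' := by
    rintro x y ⟨hx, hx'⟩ ⟨hy, hy'⟩
    refine ⟨one_le_mul hx hy, fun h => ?_⟩
    obtain ⟨h₁, h₂⟩ := (mul_eq_one_iff_of_one_le hx hy).1 h
    simpa [h₁] using Q.mul_mem (hx' h₁) (hy' h₂)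

lemma mem_heightSubmonoid {Q : Submonoid G} {x : G ≀ᵣ Multiplicative ℤ} :
    x ∈ heightSubmonoid Q ↔
      1 ≤ x.right ∧ (x.right = 1 → x.left (Multiplicative.ofAdd 1) ∈ Q) :=
  Iff.rfl

lemma shift_mul_base_mem (Q : Submonoid G) (g : G) :
    wreathShift G * wreathBase G g ∈ heightSubmonoid Q := by
  have : (1 : Multiplicative ℤ) < Multiplicative.ofAdd 1 := by decide
  refine mem_heightSubmonoid.2 ⟨?_, fun h => ?_⟩
  · simpa [wreathShift, wreathBase] using this.le
  · simp only [wreathShift, wreathBase, mul_right, MonoidHom.coe_mk, OneHom.coe_mk, mul_one] at h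
    exact absurd h this.ne'

lemma conj_base_mul_base_mem {Q : Submonoid G} {s : G} (hs : s ∈ Q) (g : G) :
    wreathShift G * wreathBase G s * (wreathShift G)⁻¹ * wreathBase G g ∈ heightSubmonoid Q := by
  refine mem_heightSubmonoid.2 ⟨by simp [wreathShift, wreathBase], fun _ => ?_⟩
  have : (Multiplicative.ofAdd 1 : Multiplicative ℤ) ≠ 1 := by decide
  simpa [wreathShift, wreathBase, Pi.mulSingle_apply, this] using hs

lemma mem_of_conj_base_mem {Q : Submonoid G} {g : G}
    (h : wreathShift G * wreathBase G g * (wreathShift G)⁻¹ ∈ heightSubmonoid Q) : g ∈ Q := by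
  have := (mem_heightSubmonoid.1 h).2 (by simp [wreathShift, wreathBase])
  simpa [wreathShift, wreathBase] using this

end Wreath

section Main

variable {k : ℕ}

/-- The quasi-positive one-relator group with relation `s · q(t b) = s`. -/
abbrev EncodingGroup (q : List (Fin k)) (s : List (Fin (k + 1))) :=
  PresentedGroup ({((s ++ pairWord q).map FreeGroup.of).prod * ((s.map FreeGroup.of).prod)⁻¹} :
    Set (FreeGroup (Fin (k + 1))))

lemma prod_map_generators (q : List (Fin k)) :
    (q.map (PresentedGroup.of (rels := {(q.map FreeGroup.of).prod}))).prod = 1 := by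
  rw [← mk_prod_map_of]
  exact PresentedGroup.one_of_mem rfl

/-- The embedding `aᵢ ↦ t bᵢ`. -/
def encodingHom (q : List (Fin k)) (s : List (Fin (k + 1))) :
    PresentedGroup ({(q.map FreeGroup.of).prod} : Set (FreeGroup (Fin k))) →*
      EncodingGroup q s :=
  PresentedGroup.toGroup
    (f := fun i => PresentedGroup.of (Fin.last k) * PresentedGroup.of i.castSucc) (by
    rintro _ rfl
    rw [lift_prod_map_of, ← prod_map_pairWord]
    refine (mul_eq_left (a := (s.map PresentedGroup.of).prod)).1 ?_
    rw [← List.prod_append, ← List.map_append]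
    exact prod_map_of_eq (s ++ pairWord q) s)

@[simp]
lemma encodingHom_of (q : List (Fin k)) (s : List (Fin (k + 1))) (i : Fin k) :
    encodingHom q s (PresentedGroup.of i) =
      PresentedGroup.of (Fin.last k) * PresentedGroup.of i.castSucc :=
  PresentedGroup.toGroup.of _

/-- The letters `bᵢ = t⁻¹ aᵢ` and `t`, evaluated along `ι`. -/
def letterValue {G H : Type*} [Group G] [Group H] (gen : Fin k → G) (ι : G →* H) (t : H) :
    Fin (k + 1) → H :=
  Fin.lastCases t fun i => t⁻¹ * ι (gen i)

lemma map_gen_eq_letterValue {G H : Type*} [Group G] [Group H] (gen : Fin k → G) (ι : G →* H)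
    (t : H) (i : Fin k) :
    ι (gen i) = letterValue gen ι t (Fin.last k) * letterValue gen ι t i.castSucc := by
  simp [letterValue]

/-- The homomorphism determined by values of `G` and of `t`. -/
def decodingHom {H : Type*} [Group H] (q : List (Fin k)) (s : List (Fin (k + 1)))
    (ι : PresentedGroup ({(q.map FreeGroup.of).prod} : Set (FreeGroup (Fin k))) →* H) (t : H) :
    EncodingGroup q s →* H :=
  PresentedGroup.toGroup (f := letterValue PresentedGroup.of ι t) (by
    rintro _ rfl
    rw [map_mul, map_inv, lift_prod_map_of, lift_prod_map_of, List.map_append, List.prod_append,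
      prod_map_pairWord_eq (map_gen_eq_letterValue PresentedGroup.of ι t), prod_map_generators,
      map_one, mul_one, mul_inv_cancel])

lemma decodingHom_of {H : Type*} [Group H] (q : List (Fin k)) (s : List (Fin (k + 1)))
    (ι : PresentedGroup ({(q.map FreeGroup.of).prod} : Set (FreeGroup (Fin k))) →* H) (t : H)
    (j : Fin (k + 1)) :
    decodingHom q s ι t (PresentedGroup.of j) = letterValue PresentedGroup.of ι t j :=
  PresentedGroup.toGroup.of _

lemma decodingHom_comp_encodingHom {H : Type*} [Group H] (q : List (Fin k))
    (s : List (Fin (k + 1)))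
    (ι : PresentedGroup ({(q.map FreeGroup.of).prod} : Set (FreeGroup (Fin k))) →* H) (t : H) :
    (decodingHom q s ι t).comp (encodingHom q s) = ι := by
  refine PresentedGroup.ext fun i => ?_
  simp [decodingHom_of, letterValue]

/-- The encoding group is the free product of the original group and an infinite cyclic group. -/
def encodingEquiv (q : List (Fin k)) (s : List (Fin (k + 1))) :
    EncodingGroup q s ≃* Monoid.Coprod
      (PresentedGroup ({(q.map FreeGroup.of).prod} : Set (FreeGroup (Fin k))))
      (Multiplicative ℤ) :=
  MonoidHom.toMulEquiv
    (decodingHom q s Monoid.Coprod.inl (Monoid.Coprod.inr (Multiplicative.ofAdd 1)))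
    (Monoid.Coprod.lift (encodingHom q s) (zpowersHom _ (PresentedGroup.of (Fin.last k))))
    (PresentedGroup.ext fun j => by
      induction j using Fin.lastCases <;> simp [decodingHom_of, letterValue])
    (Monoid.Coprod.hom_ext
      (by
        rw [MonoidHom.comp_assoc, Monoid.Coprod.lift_comp_inl, decodingHom_comp_encodingHom,
          MonoidHom.id_comp])
      (by
        rw [MonoidHom.comp_assoc, Monoid.Coprod.lift_comp_inr, MonoidHom.id_comp]
        refine MonoidHom.ext_mint ?_
        simp [decodingHom_of, letterValue]))

/-- The signed word over the larger alphabet spelling `t w t⁻¹` with `aᵢ = t bᵢ`. -/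
def conjTranslation (w : List (Fin k × Bool)) : List (Fin (k + 1) × Bool) :=
  (Fin.last k, false) :: w.flatMap (fun p =>
    if p.2 then [(p.1.castSucc, true), (Fin.last k, true)]
    else [(Fin.last k, false), (p.1.castSucc, false)]) ++ [(Fin.last k, true)]

lemma computable_conjTranslation : Computable (conjTranslation (k := k)) := by
  have h : Primrec fun w : List (Fin k × Bool) => w.flatMap fun p =>
      if p.2 then [(p.1.castSucc, true), (Fin.last k, true)]
      else [(Fin.last k, false), (p.1.castSucc, false)] :=
    Primrec.list_flatMap Primrec.id <| (Primrec.comp (Primrec.dom_finite fun p : Fin k × Bool =>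
      if p.2 then [(p.1.castSucc, true), (Fin.last k, true)]
      else [(Fin.last k, false), (p.1.castSucc, false)]) Primrec.snd).to₂
  exact (Primrec.list_append.comp (Primrec.list_cons.comp (Primrec.const _) h)
    (Primrec.const _)).to_comp

lemma evalGrpWord_conjTranslation {G H : Type*} [Group G] [Group H] {gen : Fin k → G}
    {ι : G →* H} {f : Fin (k + 1) → H}
    (hι : ∀ i, ι (gen i) = f (Fin.last k) * f i.castSucc) (w : List (Fin k × Bool)) :
    evalGrpWord f (conjTranslation w) =
      f (Fin.last k) * ι (evalGrpWord gen w) * (f (Fin.last k))⁻¹ := by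
  have key : evalGrpWord f (w.flatMap (fun p =>
      if p.2 then [(p.1.castSucc, true), (Fin.last k, true)]
      else [(Fin.last k, false), (p.1.castSucc, false)])) = ι (evalGrpWord gen w) := by
    induction w with
    | nil => simp [evalGrpWord]
    | cons p w ih =>
      rw [List.flatMap_cons, evalGrpWord_append, ih]
      obtain ⟨i, b⟩ := p
      cases b <;> simp [evalGrpWord, hι]
  rw [conjTranslation, evalGrpWord_append, ← List.singleton_append, evalGrpWord_append, key]
  simp [evalGrpWord]

lemma exists_positive_word {q : List (Fin k)}
    (hgroup : ∃ θ : OneRelMonoid q [] →*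
        PresentedGroup ({(q.map FreeGroup.of).prod} : Set (FreeGroup (Fin k))),
      (∀ i : Fin k, θ (PresentedMonoid.of _ i) = PresentedGroup.of i) ∧
      Function.Bijective θ)
    (g : PresentedGroup ({(q.map FreeGroup.of).prod} : Set (FreeGroup (Fin k)))) :
    ∃ w : List (Fin k), (w.map PresentedGroup.of).prod = g := by
  obtain ⟨θ, hθ, -, hsurj⟩ := hgroup
  obtain ⟨m, rfl⟩ := hsurj g
  obtain ⟨w, rfl⟩ := PresentedMonoid.surjective_mk m
  refine ⟨w.toList, ?_⟩
  induction w using FreeMonoid.inductionOn' with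
  | one => simp
  | of_mul i w ih =>
    rw [FreeMonoid.toList_mul, map_mul, map_mul, ← ih]
    simp only [FreeMonoid.toList_of, List.singleton_append, List.map_cons, List.prod_cons]
    congr 1
    exact (hθ i).symm

lemma getLast?_append_pairWord_ne (q : List (Fin k)) (hq : q ≠ []) (s : List (Fin (k + 1))) :
    (s ++ [Fin.last k] ++ pairWord q).getLast? ≠ (s ++ [Fin.last k]).getLast? := by
  obtain ⟨q', i, rfl⟩ := List.eq_nil_or_concat q |>.resolve_left hq
  have : pairWord (q' ++ [i]) = pairWord q' ++ [Fin.last k] ++ [i.castSucc] := by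
    simp [pairWord]
  rw [List.concat_eq_append, this, ← List.append_assoc, List.getLast?_concat,
    List.getLast?_concat]
  simp

end Main

/-- Let `q` be a nonempty positive word over a finite alphabet such that the natural map
from `Mon⟨A | q = 1⟩` to `G = Gp⟨A | q = 1⟩` is an isomorphism, and let `Q` be the
submonoid of `G` generated by a finite subset.  Then there is a quasi-positive one-relator
group `G' = Gp⟨Y | u v⁻¹ = 1⟩` with `G' ≅ G ∗ ℤ` such that decidability of the prefix
membership problem of this presentation implies decidability of the membership problem
for `Q` in `G`. -/
theorem prefix_membership_of_quasi_positive_encodes_submonoid_membership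
    (k : ℕ) (q : List (Fin k)) (hq : q ≠ [])
    (hgroup : ∃ θ : OneRelMonoid q [] →*
        PresentedGroup ({(q.map FreeGroup.of).prod} : Set (FreeGroup (Fin k))),
      (∀ i : Fin k, θ (PresentedMonoid.of _ i) = PresentedGroup.of i) ∧
      Function.Bijective θ)
    (F : Finset (PresentedGroup ({(q.map FreeGroup.of).prod} : Set (FreeGroup (Fin k))))) :
    ∃ (k' : ℕ) (u v : List (Fin k')),
      u ≠ [] ∧ v ≠ [] ∧ u.getLast? ≠ v.getLast? ∧
      Nonempty ((PresentedGroup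
          ({(u.map FreeGroup.of).prod * ((v.map FreeGroup.of).prod)⁻¹} :
            Set (FreeGroup (Fin k')))) ≃*
        Monoid.Coprod
          (PresentedGroup ({(q.map FreeGroup.of).prod} : Set (FreeGroup (Fin k))))
          (Multiplicative ℤ)) ∧
      ((ComputablePred fun w : List (Fin k' × Bool) =>
          evalGrpWord (fun i => PresentedGroup.of i) w ∈ prefixMonoid u v) →
        ComputablePred fun w : List (Fin k × Bool) =>
          evalGrpWord (fun i => PresentedGroup.of i) w ∈
            Submonoid.closure (F : Set (PresentedGroup
              ({(q.map FreeGroup.of).prod} : Set (FreeGroup (Fin k)))))) := by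
  choose σ hσ using exists_positive_word hgroup
  obtain ⟨a, -⟩ := List.exists_mem_of_ne_nil q hq
  set L := F.toList
  set s₀ := stemWord a (σ (PresentedGroup.of a)⁻¹) σ L with hs₀
  set s := s₀ ++ [Fin.last k] with hs
  have hι := encodingHom_of q s
  refine ⟨k + 1, s ++ pairWord q, s, by simp [hs], by simp [hs],
    getLast?_append_pairWord_ne q hq s₀, ⟨encodingEquiv q s⟩, fun hdec => ?_⟩
  refine ComputablePred.computable_of_manyOneReducible
    ⟨conjTranslation, computable_conjTranslation, fun w => ?_⟩ hdec
  rw [evalGrpWord_conjTranslation hι]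
  set g := evalGrpWord (fun i => PresentedGroup.of i) w
  set Q := Submonoid.closure (F : Set (PresentedGroup
    ({(q.map FreeGroup.of).prod} : Set (FreeGroup (Fin k)))))
  constructor
  · intro hg
    suffices Q ≤ (prefixMonoid (s ++ pairWord q) s).comap
        ((MulAut.conj (PresentedGroup.of (Fin.last k))).toMonoidHom.comp (encodingHom q s)) from
      this hg
    rw [Submonoid.closure_le]
    intro x hx
    obtain ⟨p, hp, hpx⟩ := exists_prefix_stemWord hι (hσ _) hσ L
      (Finset.mem_toList.2 (Finset.mem_coe.1 hx))
    have hmem := prod_map_of_mem_prefixMonoid (v := s)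
      (hp.trans ((List.prefix_append s₀ [Fin.last k]).trans (List.prefix_append s (pairWord q))))
    rw [hpx] at hmem
    exact hmem
  · intro hg
    set ψ := decodingHom q s (wreathBase _) (wreathShift _)
    have hψ : ∀ x, ψ (encodingHom q s x) = wreathBase _ x :=
      DFunLike.congr_fun (decodingHom_comp_encodingHom q s (wreathBase _) (wreathShift _))
    let f : Fin (k + 1) → _ := fun i => ψ (PresentedGroup.of i)
    have hlast : f (Fin.last k) = wreathShift _ := by
      simp [f, ψ, decodingHom_of, letterValue]
    have hι' : ∀ i, wreathBase _ (PresentedGroup.of i) =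
        f (Fin.last k) * f i.castSucc := fun i => by
      rw [← hψ, hι, map_mul]
    have hN₀ : ∀ x ∈ Q, ∀ y, f (Fin.last k) * wreathBase _ x *
        (f (Fin.last k))⁻¹ * wreathBase _ y ∈ heightSubmonoid Q := by
      rw [hlast]
      exact fun x hx => conj_base_mul_base_mem hx
    have hN₁ : ∀ y, f (Fin.last k) * wreathBase _ y ∈
        heightSubmonoid Q := by
      rw [hlast]
      exact shift_mul_base_mem Q
    have ht : f (Fin.last k) ∈ heightSubmonoid Q := by simpa using hN₁ 1
    have hstem : PrefixesIn (heightSubmonoid Q) f 1 s₀ :=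
      prefixesIn_stemWord hι' (hσ _) hσ hN₀ hN₁
        fun x hx => Submonoid.subset_closure (Finset.mem_toList.1 hx)
    have hval : 1 * (s₀.map f).prod = 1 := by
      rw [one_mul]
      exact prod_map_stemWord hι' (hσ _) hσ L
    have hv : PrefixesIn (heightSubmonoid Q) f 1 s := by
      refine hstem.append ?_
      rw [hval]
      exact .cons (one_mem _) (prefixesIn_nil (by simpa using ht))
    have hu : PrefixesIn (heightSubmonoid Q) f 1
        (s ++ pairWord q) := by
      refine hv.append (prefixesIn_pairWord hι' ht (fun y => ?_) q)
      rw [hs, List.map_append, List.prod_append, ← mul_assoc, hval]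
      simpa using hN₁ y
    have := prefixMonoid_le_comap ψ hu hv hg
    rw [Submonoid.mem_comap, map_mul, map_mul, map_inv, hψ] at this
    exact mem_of_conj_base_mem (hlast ▸ this)
end
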